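/- arXiv:1105.3441 — 5 statements merged into one kernel-verified Lean document; each statement's English description precedes it below -/
import Mathlib

section
/- Let p be the unique real number in (0,1) satisfying p^3 = (1-p)^2. Then the Hausdorff dimension of the multiplicative golden mean shift Ξ_G equals -log₂ p. -/
open scoped ENNReal

/-- The multiplicative golden mean shift: reals in `[0,1]` admitting a binary expansion
`x = ∑_{k ≥ 1} x_k 2^{-k}` with digits `x_k ∈ {0,1}` satisfying `x_k x_{2k} = 0` for all
`k ≥ 1`. -/
def XiG : Set ℝ :=
  {x | ∃ a : ℕ → ℕ, (∀ k, 1 ≤ k → a k ≤ 1) ∧ (∀ k, 1 ≤ k → a k * a (2 * k) = 0) ∧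
    x = ∑' k : ℕ, (a (k + 1) : ℝ) / 2 ^ (k + 1)}

open Filter Topology MeasureTheory ProbabilityTheory

namespace GoldenMeanShift

/-- The number of ones among the first `n` digits. -/
def ones (a : ℕ → ℕ) (n : ℕ) : ℕ := ∑ k ∈ Finset.range n, a (k + 1)

/-- The integer whose binary digits are the first `n` digits of `a`. -/
def prefixVal (a : ℕ → ℕ) : ℕ → ℕ
  | 0 => 0
  | n + 1 => 2 * prefixVal a n + a (n + 1)

/-- The digit at `k / 2` if `k` is even, and `0` otherwise. -/
def parent (a : ℕ → ℕ) (k : ℕ) : ℕ := if 2 ∣ k then a (k / 2) else 0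

/-- The conditional probability of the digit at `k` given its parent. -/
noncomputable def transition (p : ℝ) (a : ℕ → ℕ) (k : ℕ) : ℝ :=
  if parent a k = 0 then (if a k = 0 then p else 1 - p) else (if a k = 0 then 1 else 0)

/-- The probability of the cylinder fixing the first `n` digits. -/
noncomputable def weight (p : ℝ) (a : ℕ → ℕ) (n : ℕ) : ℝ :=
  ∏ k ∈ Finset.range n, transition p a (k + 1)

/-- Binary digit sequences satisfying the multiplicative golden mean constraint. -/
structure Admissible (a : ℕ → ℕ) : Prop where
  le_one : ∀ k, 1 ≤ k → a k ≤ 1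
  mul_eq_zero : ∀ k, 1 ≤ k → a k * a (2 * k) = 0

lemma sum_parent (a : ℕ → ℕ) (n : ℕ) :
    ∑ k ∈ Finset.range n, parent a (k + 1) = ones a (n / 2) := by
  induction n with
  | zero => simp [ones]
  | succ n ih =>
    rw [Finset.sum_range_succ, ih, parent]
    split_ifs with h
    · obtain ⟨m, hm⟩ := h
      obtain ⟨m, rfl⟩ : ∃ l, m = l + 1 := ⟨m - 1, by omega⟩
      have h1 : n / 2 = m := by omega
      have h2 : (n + 1) / 2 = m + 1 := by omega
      rw [h1, h2, ones, ones, Finset.sum_range_succ]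
    · have : (n + 1) / 2 = n / 2 := by omega
      rw [this, add_zero]

lemma ones_le {a : ℕ → ℕ} (ha : ∀ k, 1 ≤ k → a k ≤ 1) (n : ℕ) : ones a n ≤ n := by
  calc ones a n ≤ ∑ k ∈ Finset.range n, 1 := Finset.sum_le_sum fun k _ => ha _ (by omega)
    _ = n := by simp

lemma one_sub_eq_rpow {p : ℝ} (hp : p ∈ Set.Ioo (0 : ℝ) 1) (hpe : p ^ 3 = (1 - p) ^ 2) :
    1 - p = p ^ (3 / 2 : ℝ) := by
  have h0 := hp.1
  have h1 : (0 : ℝ) ≤ 1 - p := by linarith [hp.2]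
  have h2 : (p ^ (3 / 2 : ℝ)) ^ 2 = (1 - p) ^ 2 := by
    rw [← hpe, ← Real.rpow_natCast, ← Real.rpow_mul h0.le, ← Real.rpow_natCast]
    norm_num
  exact ((pow_left_inj₀ (by positivity) h1 two_ne_zero).1 h2).symm

lemma Admissible.transition_eq {a : ℕ → ℕ} (ha : Admissible a) {p : ℝ}
    (hp : p ∈ Set.Ioo (0 : ℝ) 1) (hpe : p ^ 3 = (1 - p) ^ 2) {k : ℕ} (hk : 1 ≤ k) :
    transition p a k = p ^ (1 + (a k : ℝ) / 2 - parent a k) := by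
  have h1 : a k = 0 ∨ a k = 1 := by have := ha.le_one k hk; omega
  have h2 : parent a k = 0 ∨ (parent a k = 1 ∧ a k = 0) := by
    unfold parent
    split_ifs with h
    · obtain ⟨m, rfl⟩ := h
      have h3 := ha.le_one m (by omega)
      have h4 := ha.mul_eq_zero m (by omega)
      rw [Nat.mul_div_cancel_left _ two_pos]
      rcases Nat.mul_eq_zero.1 h4 with h | h <;> omega
    · simp
  have h3 := one_sub_eq_rpow hp hpe
  unfold transition
  rcases h2 with h2 | ⟨h2, h4⟩
  · rcases h1 with h1 | h1
    · simp [h1, h2]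
    · simp only [h1, h2, if_true, one_ne_zero, if_false, h3]
      norm_num
  · simp [h2, h4]

lemma Admissible.weight_eq {a : ℕ → ℕ} (ha : Admissible a) {p : ℝ}
    (hp : p ∈ Set.Ioo (0 : ℝ) 1) (hpe : p ^ 3 = (1 - p) ^ 2) (n : ℕ) :
    weight p a n = p ^ (n + (ones a n : ℝ) / 2 - ones a (n / 2)) := by
  unfold weight
  rw [Finset.prod_congr rfl fun k _ => ha.transition_eq hp hpe (Nat.le_add_left 1 k),
    ← Real.rpow_sum_of_pos hp.1, Finset.sum_sub_distrib, Finset.sum_add_distrib,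
    ← Finset.sum_div, ← sum_parent, ones]
  simp

lemma parent_congr {a b : ℕ → ℕ} {n : ℕ} (h : ∀ k, 1 ≤ k → k ≤ n → a k = b k) {k : ℕ}
    (h1 : 1 ≤ k) (h2 : k ≤ 2 * n + 1) : parent a k = parent b k := by
  unfold parent
  split_ifs with hd
  · exact h _ (by omega) (by omega)
  · rfl

lemma weight_congr {a b : ℕ → ℕ} (p : ℝ) {n : ℕ} (h : ∀ k, 1 ≤ k → k ≤ n → a k = b k) :
    weight p a n = weight p b n := by
  refine Finset.prod_congr rfl fun k hk => ?_
  rw [Finset.mem_range] at hk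
  simp only [transition, parent_congr h (Nat.le_add_left 1 k) (by omega),
    h (k + 1) (by omega) (by omega)]

lemma prefixVal_congr {a b : ℕ → ℕ} {n : ℕ} (h : ∀ k, 1 ≤ k → k ≤ n → a k = b k) :
    prefixVal a n = prefixVal b n := by
  induction n with
  | zero => rfl
  | succ n ih =>
    rw [prefixVal, prefixVal, ih fun k h1 h2 => h k h1 (by omega), h (n + 1) (by omega) le_rfl]

lemma eq_of_prefixVal_eq {a b : ℕ → ℕ} (ha : ∀ k, 1 ≤ k → a k ≤ 1) (hb : ∀ k, 1 ≤ k → b k ≤ 1)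
    {n : ℕ} (h : prefixVal a n = prefixVal b n) {k : ℕ} (h1 : 1 ≤ k) (hn : k ≤ n) :
    a k = b k := by
  induction n with
  | zero => omega
  | succ n ih =>
    rw [prefixVal, prefixVal] at h
    have h2 := ha (n + 1) (by omega)
    have h3 := hb (n + 1) (by omega)
    rcases hn.lt_or_eq with h4 | rfl
    · exact ih (by omega) (by omega)
    · omega

/-- The indicator sequence of a finite set. -/
def ind (S : Finset ℕ) (k : ℕ) : ℕ := if k ∈ S then 1 else 0

lemma transition_add_transition {a b : ℕ → ℕ} (p : ℝ) {n : ℕ}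
    (h : ∀ k, 1 ≤ k → k ≤ n → a k = b k) (ha : a (n + 1) = 0) (hb : b (n + 1) = 1) :
    transition p a (n + 1) + transition p b (n + 1) = 1 := by
  unfold transition
  rw [parent_congr h (Nat.le_add_left 1 n) (by omega), ha, hb]
  split_ifs <;> simp_all

lemma sum_weight (p : ℝ) (n : ℕ) :
    ∑ S ∈ (Finset.Icc 1 n).powerset, weight p (ind S) n = 1 := by
  induction n with
  | zero => simp [weight]
  | succ n ih =>
    rw [← Finset.insert_Icc_right_eq_Icc_add_one (by omega),
      Finset.sum_powerset_insert (by simp), ← ih, ← Finset.sum_add_distrib]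
    refine Finset.sum_congr rfl fun S hS => ?_
    have hS' : n + 1 ∉ S := fun h => by
      have := Finset.mem_powerset.1 hS h
      simp at this
    have hc : ∀ k, 1 ≤ k → k ≤ n → ind S k = ind (insert (n + 1) S) k := by
      intro k _ hk
      simp [ind, show k ≠ n + 1 by omega]
    have h1 := transition_add_transition p hc (by simp [ind, hS']) (by simp [ind])
    have h2 := weight_congr p hc
    unfold weight at h2 ⊢
    rw [Finset.prod_range_succ, Finset.prod_range_succ, ← h2, ← mul_add, h1, mul_one]

lemma transition_nonneg {p : ℝ} (hp : p ∈ Set.Ioo (0 : ℝ) 1) (a : ℕ → ℕ) (k : ℕ) :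
    0 ≤ transition p a k := by
  unfold transition
  split_ifs <;> linarith [hp.1, hp.2]

lemma weight_nonneg {p : ℝ} (hp : p ∈ Set.Ioo (0 : ℝ) 1) (a : ℕ → ℕ) (n : ℕ) :
    0 ≤ weight p a n :=
  Finset.prod_nonneg fun _ _ => transition_nonneg hp a _

/-- The real number with binary digits `a`. -/
noncomputable def toReal (a : ℕ → ℕ) : ℝ := ∑' k : ℕ, (a (k + 1) : ℝ) / 2 ^ (k + 1)

lemma sum_digits_eq (a : ℕ → ℕ) (n : ℕ) :
    ∑ k ∈ Finset.range n, (a (k + 1) : ℝ) / 2 ^ (k + 1) = prefixVal a n / 2 ^ n := by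
  induction n with
  | zero => simp [prefixVal]
  | succ n ih =>
    rw [Finset.sum_range_succ, ih, prefixVal]
    push_cast
    field_simp
    ring

lemma tendsto_prefixVal {a : ℕ → ℕ} (ha : ∀ k, 1 ≤ k → a k ≤ 1) :
    Tendsto (fun n => (prefixVal a n : ℝ) / 2 ^ n) atTop (𝓝 (toReal a)) := by
  have hs : Summable fun k : ℕ => (a (k + 1) : ℝ) / 2 ^ (k + 1) := by
    refine Summable.of_nonneg_of_le (fun k => by positivity) (fun k => ?_)
      (summable_geometric_two.mul_left 1)
    have h1 : (a (k + 1) : ℝ) ≤ 1 := by exact_mod_cast ha (k + 1) (by omega)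
    rw [one_mul, div_pow, one_pow]
    gcongr <;> first | exact h1 | norm_num
  simpa only [sum_digits_eq, toReal] using hs.hasSum.tendsto_sum_nat

lemma prefixVal_div_le {a : ℕ → ℕ} (ha : ∀ k, 1 ≤ k → a k ≤ 1) (n : ℕ) :
    (prefixVal a n : ℝ) / 2 ^ n ≤ toReal a := by
  refine (monotone_nat_of_le_succ fun m => ?_).ge_of_tendsto (tendsto_prefixVal ha) n
  rw [prefixVal]
  push_cast
  rw [div_le_div_iff₀ (by positivity) (by positivity), pow_succ]
  have : (0 : ℝ) ≤ a (m + 1) * 2 ^ m := by positivity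
  nlinarith

lemma le_prefixVal_add_one_div {a : ℕ → ℕ} (ha : ∀ k, 1 ≤ k → a k ≤ 1) (n : ℕ) :
    toReal a ≤ ((prefixVal a n : ℝ) + 1) / 2 ^ n := by
  have ht : Tendsto (fun n => ((prefixVal a n : ℝ) + 1) / 2 ^ n) atTop (𝓝 (toReal a)) := by
    have h := (tendsto_prefixVal ha).add (tendsto_pow_atTop_nhds_zero_of_lt_one
      (r := (1 / 2 : ℝ)) (by norm_num) (by norm_num))
    simpa [add_div] using h
  refine (antitone_nat_of_succ_le fun m => ?_).le_of_tendsto ht n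
  rw [prefixVal]
  push_cast
  have h1 : (a (m + 1) : ℝ) ≤ 1 := by exact_mod_cast ha (m + 1) (by omega)
  rw [div_le_div_iff₀ (by positivity) (by positivity), pow_succ]
  have : (a (m + 1) : ℝ) * 2 ^ m ≤ 1 * 2 ^ m := by gcongr
  nlinarith

lemma exists_ones_deficit_le {a : ℕ → ℕ} (ha : ∀ k, 1 ≤ k → a k ≤ 1) {ε : ℝ} (hε : 0 < ε)
    (j₀ : ℕ) : ∃ j ≥ j₀, (ones a (2 ^ j) : ℝ) / 2 - ones a (2 ^ j / 2) ≤ ε * 2 ^ j := by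
  by_contra! hcon
  have key : ∀ m : ℕ, ε * m ≤ (ones a (2 ^ (j₀ + m)) : ℝ) / 2 ^ (j₀ + m) := by
    intro m
    induction m with
    | zero => simp; positivity
    | succ m ih =>
      have h1 := hcon (j₀ + m + 1) (by omega)
      rw [show 2 ^ (j₀ + m + 1) / 2 = 2 ^ (j₀ + m) by rw [pow_succ]; omega] at h1
      rw [← add_assoc, le_div_iff₀ (by positivity)]
      rw [le_div_iff₀ (by positivity)] at ih
      push_cast
      rw [pow_succ] at h1 ⊢
      have : (0 : ℝ) < ε * 2 ^ (j₀ + m) := by positivity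
      nlinarith
  obtain ⟨m, hm⟩ := exists_nat_gt (1 / ε)
  have h1 := key m
  have h2 : (ones a (2 ^ (j₀ + m)) : ℝ) / 2 ^ (j₀ + m) ≤ 1 := by
    rw [div_le_one (by positivity)]
    exact_mod_cast ones_le ha _
  rw [div_lt_iff₀ hε] at hm
  linarith

lemma ind_filter_eq {a : ℕ → ℕ} (ha : ∀ k, 1 ≤ k → a k ≤ 1) (n : ℕ) {k : ℕ} (h1 : 1 ≤ k)
    (hn : k ≤ n) : ind ((Finset.Icc 1 n).filter fun k => a k = 1) k = a k := by
  have := ha k h1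
  simp only [ind, Finset.mem_filter, Finset.mem_Icc]
  split_ifs <;> omega

/-- The words of length `n` (as sets of positions of ones) of probability at least `c`. -/
noncomputable def heavy (p : ℝ) (n : ℕ) (c : ℝ) : Finset (Finset ℕ) :=
  (Finset.Icc 1 n).powerset.filter fun S => c ≤ weight p (ind S) n

lemma card_heavy_mul_le {p : ℝ} (hp : p ∈ Set.Ioo (0 : ℝ) 1) (n : ℕ) (c : ℝ) :
    (heavy p n c).card * c ≤ 1 := by
  rw [← sum_weight p n, ← nsmul_eq_mul]
  refine (Finset.card_nsmul_le_sum _ _ c fun S hS => (Finset.mem_filter.1 hS).2).trans ?_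
  exact Finset.sum_le_sum_of_subset_of_nonneg (Finset.filter_subset _ _)
    fun S _ _ => weight_nonneg hp _ _

/-- The interval of reals whose first `n` binary digits are given by `S`. -/
noncomputable def dyadic (n : ℕ) (S : Finset ℕ) : Set ℝ :=
  Set.Icc ((prefixVal (ind S) n : ℝ) / 2 ^ n) (((prefixVal (ind S) n : ℝ) + 1) / 2 ^ n)

lemma ediam_dyadic (n : ℕ) (S : Finset ℕ) :
    Metric.ediam (dyadic n S) = ENNReal.ofReal ((1 / 2) ^ n) := by
  rw [dyadic, Real.ediam_Icc, add_div, add_sub_cancel_left, div_pow, one_pow]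

lemma Admissible.exists_mem_dyadic {a : ℕ → ℕ} (ha : Admissible a) {p : ℝ}
    (hp : p ∈ Set.Ioo (0 : ℝ) 1) (hpe : p ^ 3 = (1 - p) ^ 2) {ε : ℝ} (hε : 0 < ε) (j₀ : ℕ) :
    ∃ j ≥ j₀, ∃ S ∈ heavy p (2 ^ j) (p ^ ((1 + ε) * 2 ^ j)), toReal a ∈ dyadic (2 ^ j) S := by
  obtain ⟨j, hj, h⟩ := exists_ones_deficit_le ha.le_one hε j₀
  have hS : ∀ k, 1 ≤ k → k ≤ 2 ^ j → ind ((Finset.Icc 1 (2 ^ j)).filter fun k => a k = 1) k = a k :=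
    fun k h1 h2 => ind_filter_eq ha.le_one _ h1 h2
  refine ⟨j, hj, (Finset.Icc 1 (2 ^ j)).filter fun k => a k = 1, ?_, ?_⟩
  · rw [heavy, Finset.mem_filter, Finset.mem_powerset, weight_congr p hS, ha.weight_eq hp hpe]
    refine ⟨Finset.filter_subset _ _, Real.rpow_le_rpow_of_exponent_ge hp.1 hp.2.le ?_⟩
    push_cast
    linarith
  · rw [dyadic, prefixVal_congr hS]
    exact ⟨prefixVal_div_le ha.le_one _, le_prefixVal_add_one_div ha.le_one _⟩

lemma XiG_eq : XiG = {x | ∃ a, Admissible a ∧ x = toReal a} := by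
  ext x
  constructor
  · rintro ⟨a, h1, h2, h3⟩
    exact ⟨a, ⟨h1, h2⟩, h3⟩
  · rintro ⟨a, ⟨h1, h2⟩, h3⟩
    exact ⟨a, h1, h2, h3⟩

/-- The covering sets used at scale `j₀`. -/
noncomputable def cover (p ε : ℝ) (j₀ : ℕ) (i : ℕ × Finset ℕ) : Set ℝ :=
  open Classical in
  if j₀ ≤ i.1 ∧ i.2 ∈ heavy p (2 ^ i.1) (p ^ ((1 + ε) * 2 ^ i.1)) then dyadic (2 ^ i.1) i.2 else ∅

lemma ediam_cover_le (p ε : ℝ) (j₀ : ℕ) (i : ℕ × Finset ℕ) :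
    Metric.ediam (cover p ε j₀ i) ≤ ENNReal.ofReal ((1 / 2) ^ j₀) := by
  unfold cover
  split_ifs with h
  · rw [ediam_dyadic]
    refine ENNReal.ofReal_le_ofReal (pow_le_pow_of_le_one (by norm_num) (by norm_num) ?_)
    exact h.1.trans Nat.lt_two_pow_self.le
  · simp

lemma tsum_ediam_cover_le {p : ℝ} (hp : p ∈ Set.Ioo (0 : ℝ) 1) {ε d : ℝ} (hd : 0 < d)
    (hdε : (1 + ε) * (-Real.logb 2 p) < d) (j₀ : ℕ) :
    ∑' i, Metric.ediam (cover p ε j₀ i) ^ d ≤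
      ∑' j : ℕ, ENNReal.ofReal (2 ^ ((1 + ε) * (-Real.logb 2 p) - d)) ^ j := by
  rw [ENNReal.tsum_prod']
  refine ENNReal.tsum_le_tsum fun j => ?_
  set δ := (1 + ε) * (-Real.logb 2 p) - d with hδ
  set H := heavy p (2 ^ j) (p ^ ((1 + ε) * 2 ^ j)) with hH
  have h1 : ∀ S, Metric.ediam (cover p ε j₀ (j, S)) ^ d ≤
      if S ∈ H then ENNReal.ofReal (((1 / 2 : ℝ) ^ (2 ^ j)) ^ d) else 0 := by
    intro S
    unfold cover
    split_ifs with h h' h'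
    · simp only [ediam_dyadic]
      rw [ENNReal.ofReal_rpow_of_pos (by positivity)]
    · exact absurd h.2 h'
    · simp [hd]
    · simp [hd]
  refine (ENNReal.tsum_le_tsum h1).trans ?_
  rw [tsum_eq_sum (s := H) (fun S hS => if_neg hS), Finset.sum_ite_mem, Finset.inter_self,
    Finset.sum_const, nsmul_eq_mul, ← ENNReal.ofReal_natCast,
    ← ENNReal.ofReal_mul (by positivity), ← ENNReal.ofReal_pow (by positivity)]
  refine ENNReal.ofReal_le_ofReal ?_
  have hc : (0 : ℝ) < p ^ ((1 + ε) * 2 ^ j) := Real.rpow_pos_of_pos hp.1 _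
  have h2 : (H.card : ℝ) ≤ 2 ^ ((1 + ε) * (-Real.logb 2 p) * 2 ^ j) := by
    have h3 := card_heavy_mul_le hp (2 ^ j) (p ^ ((1 + ε) * 2 ^ j))
    rw [← le_div_iff₀ hc] at h3
    refine h3.trans_eq ?_
    conv_lhs => rw [← Real.rpow_logb two_pos (by norm_num) hp.1]
    rw [one_div, ← Real.rpow_mul two_pos.le, ← Real.rpow_neg two_pos.le]
    congr 1
    ring
  have h4 : (((1 / 2 : ℝ) ^ (2 ^ j)) ^ d) = 2 ^ (-d * 2 ^ j) := by
    rw [one_div, ← Real.rpow_natCast, Real.inv_rpow two_pos.le, ← Real.rpow_neg two_pos.le,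
      ← Real.rpow_mul two_pos.le]
    congr 1
    push_cast
    ring
  rw [h4]
  calc (H.card : ℝ) * 2 ^ (-d * 2 ^ j) ≤
        2 ^ ((1 + ε) * (-Real.logb 2 p) * 2 ^ j) * 2 ^ (-d * 2 ^ j) := by gcongr
    _ = 2 ^ (δ * 2 ^ j) := by
      rw [← Real.rpow_add two_pos]
      congr 1
      rw [hδ]
      ring
    _ ≤ 2 ^ (δ * j) := by
      refine Real.rpow_le_rpow_of_exponent_le one_le_two ?_
      have : (j : ℝ) ≤ 2 ^ j := by exact_mod_cast Nat.lt_two_pow_self.le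
      nlinarith
    _ = (2 ^ δ) ^ j := by rw [Real.rpow_mul two_pos.le, Real.rpow_natCast]

lemma dimH_le {p : ℝ} (hp : p ∈ Set.Ioo (0 : ℝ) 1) (hpe : p ^ 3 = (1 - p) ^ 2) :
    dimH XiG ≤ ENNReal.ofReal (-Real.logb 2 p) := by
  have hs : 0 < -Real.logb 2 p := by
    rw [neg_pos]
    exact Real.logb_neg one_lt_two hp.1 hp.2
  refine _root_.dimH_le fun d hd => ?_
  by_contra! hlt
  rw [ENNReal.ofReal_lt_coe_iff hs.le] at hlt
  set s := -Real.logb 2 p with hs'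
  have hd0 : (0 : ℝ) < d := hs.trans hlt
  obtain ⟨ε, hε, hdε⟩ : ∃ ε : ℝ, 0 < ε ∧ (1 + ε) * s < d := by
    refine ⟨(d - s) / (2 * s), div_pos (by linarith) (by linarith), ?_⟩
    have : (1 + ((d : ℝ) - s) / (2 * s)) * s = (d + s) / 2 := by
      field_simp
      ring
    linarith
  have hcov := Measure.hausdorffMeasure_le_liminf_tsum (ι := fun _ : ℕ => ℕ × Finset ℕ) (d : ℝ) XiG
    (l := atTop) (fun j₀ : ℕ => ENNReal.ofReal ((1 / 2) ^ j₀))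
    (by
      rw [← ENNReal.ofReal_zero]
      exact ENNReal.tendsto_ofReal
        (tendsto_pow_atTop_nhds_zero_of_lt_one (by norm_num) (by norm_num)))
    (cover p ε) (Eventually.of_forall fun j₀ => ediam_cover_le p ε j₀)
    (Eventually.of_forall fun j₀ => by
      rw [XiG_eq]
      rintro x ⟨a, ha, rfl⟩
      obtain ⟨j, hj, S, hS, hx⟩ := ha.exists_mem_dyadic hp hpe hε j₀
      refine Set.mem_iUnion.2 ⟨(j, S), ?_⟩
      rw [cover, if_pos ⟨hj, hS⟩]
      exact hx)
  rw [hd] at hcov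
  have hfin : ∑' j : ℕ, ENNReal.ofReal (2 ^ ((1 + ε) * s - d)) ^ j < ⊤ := by
    rw [ENNReal.tsum_geometric, ENNReal.inv_lt_top, tsub_pos_iff_lt, ENNReal.ofReal_lt_one]
    exact Real.rpow_lt_one_of_one_lt_of_neg one_lt_two (by linarith)
  have h1 := Filter.liminf_le_liminf (f := (atTop : Filter ℕ))
    (Eventually.of_forall fun j₀ => tsum_ediam_cover_le hp hd0 hdε j₀)
  rw [Filter.liminf_const] at h1
  exact absurd (hcov.trans h1) (not_le.2 hfin)

lemma ones_eq_add (b : ℕ → ℕ) (n : ℕ) :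
    ones b n = ∑ m ∈ Finset.range ((n + 1) / 2), b (2 * m + 1) + ones (fun k => b (2 * k)) (n / 2) := by
  induction n with
  | zero => simp [ones]
  | succ n ih =>
    have h0 : ones b (n + 1) = ones b n + b (n + 1) := Finset.sum_range_succ _ _
    rw [h0, ih]
    obtain ⟨m, rfl | rfl⟩ : ∃ m, n = 2 * m ∨ n = 2 * m + 1 := ⟨n / 2, by omega⟩
    · rw [show (2 * m + 1) / 2 = m by omega, show (2 * m + 1 + 1) / 2 = m + 1 by omega,
        show 2 * m / 2 = m by omega, Finset.sum_range_succ]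
      ring
    · rw [show (2 * m + 1 + 1 + 1) / 2 = m + 1 by omega, show (2 * m + 1 + 1) / 2 = m + 1 by omega,
        show (2 * m + 1) / 2 = m by omega, ones, ones,
        Finset.sum_range_succ (fun k => b (2 * (k + 1))) m, show 2 * m + 1 + 1 = 2 * (m + 1) by ring,
        add_assoc]

/-- The number of ones among the first `n` digits at positions whose `2`-adic valuation is `r`. -/
def levelOnes (a : ℕ → ℕ) (r n : ℕ) : ℕ :=
  ∑ m ∈ Finset.range ((n + 2 ^ r) / 2 ^ (r + 1)), a ((2 * m + 1) * 2 ^ r)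

lemma ones_eq_sum_levelOnes_add (a : ℕ → ℕ) (n R : ℕ) :
    ones a n = ∑ r ∈ Finset.range R, levelOnes a r n + ones (fun k => a (k * 2 ^ R)) (n / 2 ^ R) := by
  induction R with
  | zero => simp
  | succ R ih =>
    rw [ih, Finset.sum_range_succ, add_assoc, ones_eq_add (fun k => a (k * 2 ^ R)), levelOnes,
      Nat.div_div_eq_div_mul, ← pow_succ]
    have h1 : (n / 2 ^ R + 1) / 2 = (n + 2 ^ R) / 2 ^ (R + 1) := by
      rw [pow_succ, ← Nat.div_div_eq_div_mul, Nat.add_div_right _ (by positivity)]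
    have h2 : (fun k => a (2 * k * 2 ^ R)) = fun k => a (k * 2 ^ (R + 1)) := by
      funext k
      congr 1
      ring
    rw [h1, h2]

lemma ones_eq_sum_levelOnes (a : ℕ → ℕ) (n : ℕ) :
    ones a n = ∑ r ∈ Finset.range n, levelOnes a r n := by
  rw [ones_eq_sum_levelOnes_add a n n, Nat.div_eq_of_lt Nat.lt_two_pow_self]
  simp [ones]

lemma levelOnes_le {a : ℕ → ℕ} (ha : ∀ k, 1 ≤ k → a k ≤ 1) (r n : ℕ) :
    levelOnes a r n ≤ n / 2 ^ r := by
  have h1 : levelOnes a r n ≤ (n + 2 ^ r) / 2 ^ (r + 1) := by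
    calc levelOnes a r n ≤ ∑ m ∈ Finset.range ((n + 2 ^ r) / 2 ^ (r + 1)), 1 :=
          Finset.sum_le_sum fun m _ => ha _ (Nat.mul_pos (by omega) (by positivity))
      _ = _ := by simp
  refine h1.trans ?_
  rw [pow_succ, ← Nat.div_div_eq_div_mul, Nat.add_div_right _ (by positivity)]
  generalize n / 2 ^ r = x
  omega

lemma levelOnes_of_le (a : ℕ → ℕ) {r n : ℕ} (h : n ≤ r) : levelOnes a r n = 0 := by
  have : n < 2 ^ r := h.trans_lt Nat.lt_two_pow_self
  rw [levelOnes, Nat.div_eq_of_lt (by rw [pow_succ]; omega)]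
  simp

lemma tendsto_add_div_div (b c : ℕ) (hb : 0 < b) :
    Tendsto (fun n : ℕ => (((n + c) / b : ℕ) : ℝ) / n) atTop (𝓝 (1 / b)) := by
  rw [tendsto_iff_norm_sub_tendsto_zero]
  refine squeeze_zero' (Eventually.of_forall fun _ => norm_nonneg _) ?_
    (tendsto_const_div_atTop_nhds_zero_nat ((c : ℝ) + b))
  filter_upwards [eventually_gt_atTop 0] with n hn
  have hn' : (0 : ℝ) < n := by exact_mod_cast hn
  have hb' : (1 : ℝ) ≤ b := by exact_mod_cast hb
  have h1 : (((n + c) / b : ℕ) : ℝ) * b ≤ n + c := by exact_mod_cast Nat.div_mul_le_self (n + c) b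
  have h2 : (n : ℝ) + c < (((n + c) / b : ℕ) : ℝ) * b + b := by
    exact_mod_cast Nat.lt_div_mul_add hb
  set M := (((n + c) / b : ℕ) : ℝ)
  have h3 : M / n - 1 / b = (M * b - n) / b / n := by field_simp
  have hc : (0 : ℝ) ≤ c := by positivity
  rw [h3, Real.norm_eq_abs, abs_div, abs_of_pos hn']
  gcongr
  rw [abs_div, abs_of_pos (by linarith : (0 : ℝ) < b)]
  refine (div_le_self (abs_nonneg _) hb').trans ?_
  rw [abs_le]
  constructor <;> linarith

lemma tendsto_add_div_atTop (b c : ℕ) (hb : 0 < b) :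
    Tendsto (fun n : ℕ => (n + c) / b) atTop atTop :=
  (Nat.tendsto_div_const_atTop hb.ne').comp (tendsto_add_atTop_nat c)

lemma tendsto_levelOnes_div {a : ℕ → ℕ} {r : ℕ} {q : ℝ}
    (h : Tendsto (fun n : ℕ => (∑ m ∈ Finset.range n, (a ((2 * m + 1) * 2 ^ r) : ℝ)) / n)
      atTop (𝓝 q)) :
    Tendsto (fun n : ℕ => (levelOnes a r n : ℝ) / n) atTop
      (𝓝 (q * (1 / (2 ^ (r + 1) : ℕ)))) := by
  have h1 := (h.comp (tendsto_add_div_atTop (2 ^ (r + 1)) (2 ^ r) (by positivity))).mul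
    (tendsto_add_div_div (2 ^ (r + 1)) (2 ^ r) (by positivity))
  refine h1.congr' ?_
  filter_upwards [(tendsto_add_div_atTop (2 ^ (r + 1)) (2 ^ r) (by positivity)).eventually_gt_atTop 0]
    with n hn
  have hn' : (((n + 2 ^ r) / 2 ^ (r + 1) : ℕ) : ℝ) ≠ 0 := by exact_mod_cast hn.ne'
  simp only [Function.comp, levelOnes]
  rw [div_mul_div_cancel₀ hn']
  push_cast
  rfl

lemma exists_tendsto_ones_div {a : ℕ → ℕ} (ha : ∀ k, 1 ≤ k → a k ≤ 1)
    (h : ∀ r, ∃ q : ℝ, Tendsto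
      (fun n : ℕ => (∑ m ∈ Finset.range n, (a ((2 * m + 1) * 2 ^ r) : ℝ)) / n) atTop (𝓝 q)) :
    ∃ L : ℝ, Tendsto (fun n : ℕ => (ones a n : ℝ) / n) atTop (𝓝 L) := by
  choose q hq using h
  refine ⟨_, (tendsto_tsum_of_dominated_convergence (bound := fun r : ℕ => (1 / 2 : ℝ) ^ r)
    summable_geometric_two (fun r => tendsto_levelOnes_div (hq r))
    (Eventually.of_forall fun n r => ?_)).congr fun n => ?_⟩
  · rw [Real.norm_of_nonneg (by positivity)]
    refine div_le_of_le_mul₀ (by positivity) (by positivity) ?_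
    have h1 : (levelOnes a r n : ℝ) ≤ ((n / 2 ^ r : ℕ) : ℝ) := by exact_mod_cast levelOnes_le ha r n
    refine h1.trans (Nat.cast_div_le.trans_eq ?_)
    push_cast
    rw [div_pow, one_pow]
    ring
  · rw [tsum_eq_sum (s := Finset.range n), ← Finset.sum_div, ones_eq_sum_levelOnes]
    · push_cast
      rfl
    · intro r hr
      rw [levelOnes_of_le a (by simpa using hr)]
      simp

lemma eventually_weight_le {a : ℕ → ℕ} (ha : Admissible a) {p : ℝ}
    (hp : p ∈ Set.Ioo (0 : ℝ) 1) (hpe : p ^ 3 = (1 - p) ^ 2) {L d : ℝ}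
    (hL : Tendsto (fun n : ℕ => (ones a n : ℝ) / n) atTop (𝓝 L)) (hd : d < -Real.logb 2 p) :
    ∀ᶠ n : ℕ in atTop, weight p a n ≤ 2 ^ (-d * n) := by
  have hs : 0 < -Real.logb 2 p := by
    rw [neg_pos]
    exact Real.logb_neg one_lt_two hp.1 hp.2
  have h2 : Tendsto (fun n : ℕ => (ones a (n / 2) : ℝ) / n) atTop (𝓝 (L * (1 / (2 : ℕ)))) := by
    have ht := tendsto_add_div_atTop 2 0 two_pos
    refine ((hL.comp ht).mul (tendsto_add_div_div 2 0 two_pos)).congr' ?_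
    filter_upwards [ht.eventually_gt_atTop 0] with n hn
    simp only [Function.comp, add_zero] at hn ⊢
    have hn' : ((n / 2 : ℕ) : ℝ) ≠ 0 := by exact_mod_cast hn.ne'
    rw [div_mul_div_cancel₀ hn']
  have h3 : Tendsto (fun n : ℕ => 1 + (ones a n : ℝ) / n * (1 / (2 : ℕ)) - (ones a (n / 2) : ℝ) / n)
      atTop (𝓝 1) := by
    have := ((hL.mul_const (1 / ((2 : ℕ) : ℝ))).const_add 1).sub h2
    simpa using this
  have h4 : d / (-Real.logb 2 p) < 1 := (div_lt_one hs).2 hd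
  filter_upwards [h3.eventually_const_lt h4, eventually_gt_atTop 0] with n hn hn0
  have hn0' : (0 : ℝ) < n := by exact_mod_cast hn0
  rw [ha.weight_eq hp hpe]
  calc p ^ ((n : ℝ) + (ones a n : ℝ) / 2 - ones a (n / 2)) ≤ p ^ (d / (-Real.logb 2 p) * n) := by
        refine Real.rpow_le_rpow_of_exponent_ge hp.1 hp.2.le ?_
        have := mul_le_mul_of_nonneg_right hn.le hn0'.le
        refine this.trans_eq ?_
        push_cast
        field_simp
    _ = 2 ^ (-d * n) := by
      conv_lhs => enter [1]; rw [← Real.rpow_logb two_pos (by norm_num) hp.1]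
      rw [← Real.rpow_mul two_pos.le]
      congr 1
      have : Real.logb 2 p ≠ 0 := by linarith
      field_simp

/-- The digit sequence read off from a sequence of coin tosses: the digit at `k` is forced to be
`false` when `k` is even and the digit at `k / 2` is `true`. -/
def digit (ω : ℕ → Bool) (k : ℕ) : Bool :=
  if _h : 0 < k ∧ 2 ∣ k then ω k && !digit ω (k / 2) else ω k
termination_by k
decreasing_by omega

/-- The digit sequence as natural numbers. -/
def digits (ω : ℕ → Bool) (k : ℕ) : ℕ := (digit ω k).toNat

lemma digit_two_mul (ω : ℕ → Bool) {k : ℕ} (hk : 0 < k) :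
    digit ω (2 * k) = (ω (2 * k) && !digit ω k) := by
  rw [digit, dif_pos ⟨by omega, by omega⟩, Nat.mul_div_cancel_left _ two_pos]

lemma digit_of_not_dvd (ω : ℕ → Bool) {k : ℕ} (hk : ¬ 2 ∣ k) : digit ω k = ω k := by
  rw [digit, dif_neg fun h => hk h.2]

lemma admissible_digits (ω : ℕ → Bool) : Admissible (digits ω) where
  le_one k _ := Bool.toNat_le _
  mul_eq_zero k hk := by
    rw [digits, digits, digit_two_mul ω hk]
    cases digit ω k <;> simp

/-- The digits along a chain `i, 2 i, 4 i, …` as a function of the coin tosses along it. -/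
def chain (c : ℕ → Bool) : ℕ → Bool
  | 0 => c 0
  | r + 1 => c (r + 1) && !chain c r

lemma digit_eq_chain (ω : ℕ → Bool) (m r : ℕ) :
    digit ω ((2 * m + 1) * 2 ^ r) = chain (fun r => ω ((2 * m + 1) * 2 ^ r)) r := by
  induction r with
  | zero => simp [chain, digit_of_not_dvd]
  | succ r ih =>
    rw [chain, ← ih, show (2 * m + 1) * 2 ^ (r + 1) = 2 * ((2 * m + 1) * 2 ^ r) by ring,
      digit_two_mul ω (by positivity)]

lemma measurable_chain (r : ℕ) : Measurable fun c => chain c r := by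
  induction r with
  | zero => exact measurable_pi_apply 0
  | succ r ih =>
    exact (Measurable.of_discrete (f := fun b : Bool × Bool => b.1 && !b.2)).comp
      ((measurable_pi_apply (r + 1)).prodMk ih)

lemma measurable_digit (k : ℕ) : Measurable fun ω => digit ω k := by
  induction k using Nat.strong_induction_on with
  | _ k ih =>
    by_cases h : 0 < k ∧ 2 ∣ k
    · have h1 : (fun ω => digit ω k) = fun ω => ω k && !digit ω (k / 2) := by
        funext ω
        rw [digit, dif_pos h]
      rw [h1]
      exact (Measurable.of_discrete (f := fun b : Bool × Bool => b.1 && !b.2)).comp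
        ((measurable_pi_apply k).prodMk (ih _ (by omega)))
    · have h1 : (fun ω => digit ω k) = fun ω => ω k := by
        funext ω
        rw [digit, dif_neg h]
      rw [h1]
      exact measurable_pi_apply k

/-- The law of one coin toss. -/
noncomputable def coin (p : ℝ) : Measure Bool :=
  ENNReal.ofReal p • Measure.dirac false + ENNReal.ofReal (1 - p) • Measure.dirac true

lemma isProbabilityMeasure_coin {p : ℝ} (hp : p ∈ Set.Ioo (0 : ℝ) 1) :
    IsProbabilityMeasure (coin p) := by
  constructor
  simp only [coin, Measure.add_apply, Measure.smul_apply, measure_univ, smul_eq_mul, mul_one]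
  rw [← ENNReal.ofReal_add hp.1.le (by linarith [hp.2])]
  simp

/-- The law of a sequence of independent coin tosses. -/
noncomputable def tosses (p : ℝ) : Measure (ℕ → Bool) := Measure.infinitePi fun _ => coin p

lemma isProbabilityMeasure_tosses {p : ℝ} (hp : p ∈ Set.Ioo (0 : ℝ) 1) :
    IsProbabilityMeasure (tosses p) := by
  have := isProbabilityMeasure_coin hp
  unfold tosses
  infer_instance

lemma injective_odd_mul_two_pow :
    Function.Injective fun q : ℕ × ℕ => (2 * q.1 + 1) * 2 ^ q.2 := by
  have key : ∀ m m' r r' : ℕ, r ≤ r' → (2 * m + 1) * 2 ^ r = (2 * m' + 1) * 2 ^ r' →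
      m = m' ∧ r = r' := by
    intro m m' r r' hr h
    obtain ⟨t, rfl⟩ := Nat.exists_eq_add_of_le hr
    rw [pow_add, mul_comm (2 ^ r) (2 ^ t), ← mul_assoc] at h
    have h1 := Nat.eq_of_mul_eq_mul_right (by positivity) h
    cases t with
    | zero => simp at h1; omega
    | succ t =>
      rw [pow_succ, ← mul_assoc] at h1
      omega
  rintro ⟨m, r⟩ ⟨m', r'⟩ h
  rcases le_total r r' with hr | hr
  · obtain ⟨h1, h2⟩ := key _ _ _ _ hr h
    exact Prod.ext h1 h2
  · obtain ⟨h1, h2⟩ := key _ _ _ _ hr h.symm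
    exact Prod.ext h1.symm h2.symm

lemma measurePreserving_chains {p : ℝ} (hp : p ∈ Set.Ioo (0 : ℝ) 1) :
    MeasurePreserving (fun (ω : ℕ → Bool) (m r : ℕ) => ω ((2 * m + 1) * 2 ^ r)) (tosses p)
      (Measure.infinitePi fun _ : ℕ => tosses p) := by
  have := isProbabilityMeasure_coin hp
  refine ⟨by fun_prop, ?_⟩
  have h1 := Measure.map_infinitePi_infinitePi_of_inj (P := fun _ : ℕ => coin p)
    injective_odd_mul_two_pow
  have h2 := Measure.infinitePi_map_curry (fun _ _ : ℕ => coin p)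
  rw [← h1, Measure.map_map (MeasurableEquiv.measurable _) (by fun_prop)] at h2
  exact h2

lemma ae_tendsto_level {p : ℝ} (hp : p ∈ Set.Ioo (0 : ℝ) 1) (r : ℕ) :
    ∀ᵐ ω ∂tosses p, ∃ q : ℝ, Tendsto (fun n : ℕ =>
      (∑ m ∈ Finset.range n, (digits ω ((2 * m + 1) * 2 ^ r) : ℝ)) / n) atTop (𝓝 q) := by
  have := isProbabilityMeasure_tosses hp
  let F : (ℕ → Bool) → ℝ := fun c => ((chain c r).toNat : ℝ)
  have hF : Measurable F :=
    (Measurable.of_discrete (f := fun b : Bool => (b.toNat : ℝ))).comp (measurable_chain r)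
  have hF1 : ∀ c, ‖F c‖ ≤ 1 := fun c => by
    simp only [F]
    cases chain c r <;> simp
  have hind := iIndepFun_infinitePi (P := fun _ : ℕ => tosses p) (X := fun _ => F) fun _ => hF
  have key := strong_law_ae_real (μ := Measure.infinitePi fun _ : ℕ => tosses p)
    (fun m c => F (c m))
    (Integrable.of_bound (hF.comp (measurable_pi_apply 0)).aestronglyMeasurable 1
      (Eventually.of_forall fun c => hF1 _))
    (fun i j hij => hind.indepFun hij)
    (fun i => by
      have h : IdentDistrib (Function.eval i) (Function.eval 0)
          (Measure.infinitePi fun _ : ℕ => tosses p) (Measure.infinitePi fun _ : ℕ => tosses p) :=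
        ⟨(measurable_pi_apply i).aemeasurable, (measurable_pi_apply 0).aemeasurable, by
          rw [(measurePreserving_eval_infinitePi (fun _ : ℕ => tosses p) i).map_eq,
            (measurePreserving_eval_infinitePi (fun _ : ℕ => tosses p) 0).map_eq]⟩
      exact h.comp hF)
  filter_upwards [(measurePreserving_chains hp).quasiMeasurePreserving.ae key] with ω hω
  refine ⟨_, hω.congr fun n => ?_⟩
  simp only [digits, digit_eq_chain, F]

lemma coin_toss_eq {a : ℕ → ℕ} (ha : Admissible a) {p : ℝ}
    (hp : p ∈ Set.Ioo (0 : ℝ) 1) {k : ℕ} (hk : 1 ≤ k) :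
    coin p (if parent a k = 0 then {decide (a k = 1)} else Set.univ) =
      ENNReal.ofReal (transition p a k) := by
  have := isProbabilityMeasure_coin hp
  have h1 : a k = 0 ∨ a k = 1 := by have := ha.le_one k hk; omega
  unfold transition
  by_cases hpar : parent a k = 0
  · rcases h1 with h1 | h1 <;> simp [hpar, h1, coin]
  · have h2 : a k = 0 := by
      unfold parent at hpar
      split_ifs at hpar with h
      · obtain ⟨m, rfl⟩ := h
        rw [Nat.mul_div_cancel_left _ two_pos] at hpar
        exact (Nat.mul_eq_zero.1 (ha.mul_eq_zero m (by omega))).resolve_left hpar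
      · exact absurd rfl hpar
    rw [if_neg hpar, if_neg hpar, if_pos h2, measure_univ, ENNReal.ofReal_one]

lemma tosses_cylinder_le {a : ℕ → ℕ} (ha : Admissible a) {p : ℝ} (hp : p ∈ Set.Ioo (0 : ℝ) 1)
    (n : ℕ) : tosses p {ω | ∀ k, 1 ≤ k → k ≤ n → digits ω k = a k} ≤
      ENNReal.ofReal (weight p a n) := by
  have := isProbabilityMeasure_coin hp
  let t : ℕ → Set Bool := fun k => if parent a k = 0 then {decide (a k = 1)} else Set.univ
  have hsub : {ω | ∀ k, 1 ≤ k → k ≤ n → digits ω k = a k} ⊆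
      Set.pi ((Finset.range n).image (· + 1) : Finset ℕ) t := by
    intro ω hω k hk
    simp only [Finset.coe_image, Set.mem_image, Finset.coe_range, Set.mem_Iio] at hk
    obtain ⟨k, hk, rfl⟩ := hk
    simp only [t]
    split_ifs with hpar
    · have h1 := hω (k + 1) (by omega) (by omega)
      rw [← parent_congr hω (Nat.le_add_left 1 k) (by omega)] at hpar
      have h2 : digit ω (k + 1) = ω (k + 1) := by
        by_cases hd : 2 ∣ k + 1
        · obtain ⟨m, hm⟩ := hd
          rw [parent, if_pos ⟨m, hm⟩, hm, Nat.mul_div_cancel_left _ two_pos] at hpar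
          rw [hm, digit_two_mul ω (by omega)]
          simp only [digits] at hpar
          rw [Bool.toNat_eq_zero] at hpar
          simp [hpar]
        · exact digit_of_not_dvd ω hd
      rw [digits, h2] at h1
      rw [Set.mem_singleton_iff, ← h1]
      cases ω (k + 1) <;> simp
    · trivial
  refine (measure_mono hsub).trans_eq ?_
  rw [tosses, Measure.infinitePi_pi _ fun _ _ => MeasurableSet.of_discrete,
    Finset.prod_image (by simp), weight,
    ENNReal.ofReal_prod_of_nonneg fun _ _ => transition_nonneg hp _ _]
  exact Finset.prod_congr rfl fun k _ => coin_toss_eq ha hp (Nat.le_add_left 1 k)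

lemma measurable_toReal_digits : Measurable fun ω => toReal (digits ω) := by
  refine measurable_of_tendsto_metrizable (f := fun n ω => (prefixVal (digits ω) n : ℝ) / 2 ^ n)
    (fun n => ?_) (tendsto_pi_nhds.2 fun ω => tendsto_prefixVal (admissible_digits ω).le_one)
  simp only [← sum_digits_eq]
  refine Finset.measurable_sum _ fun k _ => Measurable.div_const ?_ _
  exact (Measurable.of_discrete (f := fun b : Bool => (b.toNat : ℝ))).comp (measurable_digit (k + 1))

/-- The coin tosses all of whose cylinders of length at least `N` have small weight. -/
def lightSet (p d : ℝ) (N : ℕ) : Set (ℕ → Bool) :=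
  {ω | ∀ n ≥ N, weight p (digits ω) n ≤ 2 ^ (-d * n)}

lemma exists_lightSet_ne_zero {p : ℝ} (hp : p ∈ Set.Ioo (0 : ℝ) 1) (hpe : p ^ 3 = (1 - p) ^ 2)
    {d : ℝ} (hd : d < -Real.logb 2 p) : ∃ N, tosses p (lightSet p d N) ≠ 0 := by
  have := isProbabilityMeasure_tosses hp
  by_contra! hcon
  have h1 : ∀ᵐ ω ∂tosses p, ω ∈ ⋃ N, lightSet p d N := by
    filter_upwards [ae_all_iff.2 (ae_tendsto_level hp)] with ω hω
    obtain ⟨L, hL⟩ := exists_tendsto_ones_div (admissible_digits ω).le_one hω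
    obtain ⟨N, hN⟩ := eventually_atTop.1 (eventually_weight_le (admissible_digits ω) hp hpe hL hd)
    exact Set.mem_iUnion.2 ⟨N, hN⟩
  have h2 := measure_iUnion_null hcon
  have h3 : ∀ᵐ ω ∂tosses p, False := by
    filter_upwards [h1, measure_eq_zero_iff_ae_notMem.1 h2] with ω h4 h5
    exact h5 h4
  exact IsProbabilityMeasure.ne_zero (tosses p) (by simpa using h3)

/-- The law of the random point of the shift, restricted to a `lightSet`. -/
noncomputable def lightLaw (p d : ℝ) (N : ℕ) : Measure ℝ :=
  ((tosses p).restrict (lightSet p d N)).map fun ω => toReal (digits ω)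

lemma lightLaw_Icc_le {p : ℝ} (hp : p ∈ Set.Ioo (0 : ℝ) 1) (d : ℝ) {N n : ℕ} (hn : N ≤ n)
    (x : ℝ) : lightLaw p d N (Set.Icc x (x + (1 / 2) ^ n)) ≤
      ENNReal.ofReal (3 * 2 ^ (-d * n)) := by
  set v := ⌈2 ^ n * x - 1⌉₊ with hv
  have hsub : (fun ω => toReal (digits ω)) ⁻¹' Set.Icc x (x + (1 / 2) ^ n) ∩ lightSet p d N ⊆
      ⋃ i ∈ Finset.range 3, lightSet p d N ∩ {ω | prefixVal (digits ω) n = v + i} := by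
    rintro ω ⟨⟨h1, h2⟩, hω⟩
    have h3 := h1.trans (le_prefixVal_add_one_div (admissible_digits ω).le_one n)
    have h4 := (prefixVal_div_le (admissible_digits ω).le_one n).trans h2
    have h2n : (0 : ℝ) < 2 ^ n := by positivity
    rw [le_div_iff₀ h2n] at h3
    rw [div_le_iff₀ h2n, add_mul, ← mul_pow] at h4
    norm_num at h4
    have h5 : v ≤ prefixVal (digits ω) n := Nat.ceil_le.2 (by linarith)
    have h6 : (prefixVal (digits ω) n : ℝ) ≤ (v + 2 : ℕ) := by
      have := Nat.le_ceil (2 ^ n * x - 1)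
      push_cast
      linarith
    have h7 : prefixVal (digits ω) n ≤ v + 2 := by exact_mod_cast h6
    simp only [Set.mem_iUnion, Finset.mem_range]
    exact ⟨prefixVal (digits ω) n - v, by omega, hω, show _ = _ by omega⟩
  have hone : ∀ u, tosses p (lightSet p d N ∩ {ω | prefixVal (digits ω) n = u}) ≤
      ENNReal.ofReal (2 ^ (-d * n)) := by
    intro u
    rcases (lightSet p d N ∩ {ω | prefixVal (digits ω) n = u}).eq_empty_or_nonempty with h | h
    · simp [h]
    · obtain ⟨ω₀, hω₀, rfl⟩ := h
      refine (measure_mono ?_).trans ((tosses_cylinder_le (admissible_digits ω₀) hp n).trans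
        (ENNReal.ofReal_le_ofReal (hω₀ n hn)))
      rintro ω ⟨-, hω⟩ k h1 h2
      exact eq_of_prefixVal_eq (admissible_digits ω).le_one (admissible_digits ω₀).le_one hω h1 h2
  rw [lightLaw, Measure.map_apply measurable_toReal_digits measurableSet_Icc,
    Measure.restrict_apply (measurable_toReal_digits measurableSet_Icc)]
  refine (measure_mono hsub).trans ((measure_biUnion_finset_le _ _).trans
    ((Finset.sum_le_sum fun i _ => hone _).trans_eq ?_))
  rw [Finset.sum_const, Finset.card_range, nsmul_eq_mul, ENNReal.ofReal_mul (by norm_num)]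
  simp

lemma lightLaw_le {p : ℝ} (hp : p ∈ Set.Ioo (0 : ℝ) 1) {d : ℝ} (hd : 0 < d) (N : ℕ)
    (E : Set ℝ) (hE : Metric.ediam E ≤ ENNReal.ofReal ((1 / 2) ^ N)) :
    lightLaw p d N E ≤ ENNReal.ofReal (3 * 2 ^ d) * Metric.ediam E ^ d := by
  have hne : Metric.ediam E ≠ ⊤ := ne_top_of_le_ne_top ENNReal.ofReal_ne_top hE
  have hbdd : Bornology.IsBounded E := Metric.isBounded_iff_ediam_ne_top.2 hne
  have hdiam := Real.ediam_eq hbdd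
  set δ := sSup E - sInf E with hδ
  have hsubset : E ⊆ Set.Icc (sInf E) (sInf E + δ) := by
    rw [hδ, add_sub_cancel]
    exact fun x hx => ⟨csInf_le hbdd.bddBelow hx, le_csSup hbdd.bddAbove hx⟩
  have hδ0 : 0 ≤ δ := sub_nonneg.2 (Real.sInf_le_sSup E hbdd.bddBelow hbdd.bddAbove)
  have hbound : ∀ n ≥ N, δ ≤ (1 / 2) ^ n →
      lightLaw p d N E ≤ ENNReal.ofReal (3 * 2 ^ (-d * n)) := fun n hn h =>
    (measure_mono (hsubset.trans (Set.Icc_subset_Icc_right (by linarith)))).trans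
      (lightLaw_Icc_le hp d hn (sInf E))
  rw [hdiam, ENNReal.ofReal_le_ofReal_iff (by positivity)] at hE
  rw [hdiam]
  rcases hδ0.eq_or_lt with h0 | h0
  · have hlim : Tendsto (fun n : ℕ => ENNReal.ofReal (3 * 2 ^ (-d * n))) atTop (𝓝 0) := by
      rw [← ENNReal.ofReal_zero, ← mul_zero (3 : ℝ)]
      refine ENNReal.tendsto_ofReal (Tendsto.const_mul _ ?_)
      simp only [Real.rpow_mul two_pos.le, Real.rpow_natCast]
      exact tendsto_pow_atTop_nhds_zero_of_lt_one (by positivity)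
        (Real.rpow_lt_one_of_one_lt_of_neg one_lt_two (by linarith))
    refine (ge_of_tendsto hlim ?_).trans zero_le
    filter_upwards [eventually_ge_atTop N] with n hn
    exact hbound n hn (by rw [← h0]; positivity)
  · obtain ⟨n, hn1, hn2⟩ := exists_nat_pow_near_of_lt_one h0
      (hE.trans (pow_le_one₀ (by norm_num) (by norm_num))) (by norm_num : (0 : ℝ) < 1 / 2)
      (by norm_num)
    have hNn : N ≤ n := by
      by_contra! hlt
      have := pow_le_pow_of_le_one (by norm_num : (0 : ℝ) ≤ 1 / 2) (by norm_num)
        (show n + 1 ≤ N from hlt)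
      linarith
    refine (hbound n hNn hn2).trans ?_
    rw [ENNReal.ofReal_rpow_of_pos h0, ← ENNReal.ofReal_mul (by positivity)]
    refine ENNReal.ofReal_le_ofReal ?_
    rw [mul_assoc]
    gcongr
    calc (2 : ℝ) ^ (-d * n) = 2 ^ d * ((1 / 2) ^ (n + 1)) ^ d := by
          rw [one_div, ← Real.rpow_natCast, Real.inv_rpow two_pos.le, ← Real.rpow_neg two_pos.le,
            ← Real.rpow_mul two_pos.le, ← Real.rpow_add two_pos]
          congr 1
          push_cast
          ring
      _ ≤ 2 ^ d * δ ^ d := by gcongr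

lemma lightLaw_XiG_ne_zero {p d : ℝ} {N : ℕ} (h : tosses p (lightSet p d N) ≠ 0) :
    lightLaw p d N XiG ≠ 0 := by
  refine ne_bot_of_le_ne_bot h ?_
  refine le_trans (le_of_eq ?_) (Measure.le_map_apply measurable_toReal_digits.aemeasurable XiG)
  have : (fun ω => toReal (digits ω)) ⁻¹' XiG = Set.univ := by
    rw [XiG_eq]
    exact Set.eq_univ_of_forall fun ω => ⟨digits ω, admissible_digits ω, rfl⟩
  rw [this, Measure.restrict_apply_univ]

lemma le_dimH {p : ℝ} (hp : p ∈ Set.Ioo (0 : ℝ) 1) (hpe : p ^ 3 = (1 - p) ^ 2) :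
    ENNReal.ofReal (-Real.logb 2 p) ≤ dimH XiG := by
  refine ENNReal.le_of_forall_nnreal_lt fun d hd => ?_
  rcases eq_or_ne d 0 with rfl | hd0
  · simp
  have hd0' : (0 : ℝ) < d := NNReal.coe_pos.2 (pos_iff_ne_zero.2 hd0)
  have hd' : (d : ℝ) < -Real.logb 2 p := by
    rwa [← ENNReal.ofReal_coe_nnreal, ENNReal.ofReal_lt_ofReal_iff_of_nonneg d.coe_nonneg] at hd
  obtain ⟨N, hN⟩ := exists_lightSet_ne_zero hp hpe hd'
  have hc0 : ENNReal.ofReal (3 * 2 ^ (d : ℝ)) ≠ 0 := by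
    rw [ne_eq, ENNReal.ofReal_eq_zero, not_le]
    positivity
  have hle := Measure.le_hausdorffMeasure (d : ℝ)
    ((ENNReal.ofReal (3 * 2 ^ (d : ℝ)))⁻¹ • lightLaw p d N) (ENNReal.ofReal ((1 / 2) ^ N))
    (by rw [ENNReal.ofReal_pos]; positivity)
    (fun E hE => by
      rw [Measure.smul_apply, smul_eq_mul, ENNReal.inv_mul_le_iff hc0 ENNReal.ofReal_ne_top]
      exact lightLaw_le hp hd0' N E hE)
  refine le_dimH_of_hausdorffMeasure_ne_zero (ne_bot_of_le_ne_bot ?_ (hle XiG))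
  rw [Measure.smul_apply, smul_eq_mul]
  exact mul_ne_zero (ENNReal.inv_ne_zero.2 ENNReal.ofReal_ne_top) (lightLaw_XiG_ne_zero hN)

end GoldenMeanShift

/-- The Hausdorff dimension of the multiplicative golden mean shift is `-log₂ p`, where
`p` is the unique root in `(0,1)` of `p³ = (1-p)²`. -/
theorem dimH_multiplicative_golden_mean_shift (p : ℝ) (hp : p ∈ Set.Ioo (0 : ℝ) 1)
    (hpe : p ^ 3 = (1 - p) ^ 2) :
    dimH XiG = ENNReal.ofReal (-Real.logb 2 p) :=
  (GoldenMeanShift.dimH_le hp hpe).antisymm (GoldenMeanShift.le_dimH hp hpe)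
end

section
/- Let p be the unique real number in (0,1) satisfying p^3 = (1-p)^2, and let F_k denote the Fibonacci numbers defined by F_1 = 1, F_2 = 2, F_{k+1} = F_{k-1} + F_k. Then -log₂ p < Σ_{k≥1} 2^{-(k+1)} log₂ F_{k+1}; that is, the Hausdorff dimension of the multiplicative golden mean shift is strictly smaller than its Minkowski dimension Σ_{k≥1} 2^{-(k+1)} log₂ F_{k+1}. -/
open scoped ENNReal

/-- The Fibonacci numbers `F₁ = 1`, `F₂ = 2`, `F_{k+1} = F_{k-1} + F_k`
(with the convention `F₀ = 1`, which is consistent with the recursion). -/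
def F : ℕ → ℕ
  | 0 => 1
  | 1 => 1
  | n + 2 => F n + F (n + 1)

/-- Conditional probability of the `k`-th digit under the Markov measure on the shift, where
`S` is the set of positions of the digit `1`. -/
noncomputable def digitWeight (p : ℝ) (S : Finset ℕ) (k : ℕ) : ℝ :=
  if 2 ∣ k ∧ k / 2 ∈ S then (if k ∈ S then 0 else 1) else if k ∈ S then 1 - p else p

/-- The probability of the word of length `n` whose digits `1` are at the positions in `S`. -/
noncomputable def wordWeight (p : ℝ) (S : Finset ℕ) (n : ℕ) : ℝ :=
  ∏ k ∈ Finset.Icc 1 n, digitWeight p S k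

/-- The positions of the digit `1` among the first `n` digits of `a`. -/
def onesUpTo (a : ℕ → ℕ) (n : ℕ) : Finset ℕ :=
  {k ∈ Finset.Icc 1 n | a k = 1}

/-- The left endpoint of the dyadic interval of the word with digits `1` at `S`. -/
noncomputable def dyadicPoint (S : Finset ℕ) : ℝ :=
  ∑ k ∈ S, (1 / 2 : ℝ) ^ k

/-- The words of length `n` whose weight is at least `c ^ n`. -/
noncomputable def heavyWords (p c : ℝ) (n : ℕ) : Finset (Finset ℕ) :=
  {S ∈ (Finset.Icc 1 n).powerset | c ^ n ≤ wordWeight p S n}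

section

open Finset Filter Topology MeasureTheory

lemma digitWeight_nonneg {p : ℝ} (h0 : 0 ≤ p) (h1 : p ≤ 1) (S : Finset ℕ) (k : ℕ) :
    0 ≤ digitWeight p S k := by
  unfold digitWeight
  split_ifs <;> linarith

lemma wordWeight_nonneg {p : ℝ} (h0 : 0 ≤ p) (h1 : p ≤ 1) (S : Finset ℕ) (n : ℕ) :
    0 ≤ wordWeight p S n :=
  prod_nonneg fun k _ => digitWeight_nonneg h0 h1 S k

lemma Icc_one_succ_eq_insert (n : ℕ) : Icc 1 (n + 1) = insert (n + 1) (Icc 1 n) := by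
  ext k
  simp only [mem_Icc, mem_insert]
  omega

lemma wordWeight_succ (p : ℝ) (S : Finset ℕ) (n : ℕ) :
    wordWeight p S (n + 1) = wordWeight p S n * digitWeight p S (n + 1) := by
  unfold wordWeight
  rw [prod_Icc_succ_top (by omega)]

lemma wordWeight_insert (p : ℝ) (S : Finset ℕ) (n : ℕ) :
    wordWeight p (insert (n + 1) S) n = wordWeight p S n := by
  refine prod_congr rfl fun k hk => ?_
  rw [mem_Icc] at hk
  have h1 : k ≠ n + 1 := by omega
  have h2 : k / 2 ≠ n + 1 := by omega
  simp [digitWeight, h1, h2]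

lemma digitWeight_add_insert (p : ℝ) {S : Finset ℕ} {k : ℕ} (hk : k ∉ S) (hk0 : k ≠ 0) :
    digitWeight p S k + digitWeight p (insert k S) k = 1 := by
  have h2 : k / 2 ≠ k := by omega
  simp only [digitWeight, mem_insert, h2, hk, false_or, true_or, if_true, if_false]
  split_ifs <;> ring

lemma sum_wordWeight (p : ℝ) (n : ℕ) :
    ∑ S ∈ (Icc 1 n).powerset, wordWeight p S n = 1 := by
  induction n with
  | zero => simp [wordWeight]
  | succ n ih =>
    have hn : n + 1 ∉ Icc 1 n := by simp
    rw [Icc_one_succ_eq_insert, sum_powerset_insert hn, ← sum_add_distrib, ← ih]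
    refine sum_congr rfl fun S hS => ?_
    have hnS : n + 1 ∉ S := fun h => hn (mem_powerset.1 hS h)
    rw [wordWeight_succ, wordWeight_succ, wordWeight_insert, ← mul_add,
      digitWeight_add_insert p hnS (by omega), mul_one]

lemma card_heavyWords_mul_le {p : ℝ} (h0 : 0 ≤ p) (h1 : p ≤ 1) (c : ℝ) (n : ℕ) :
    #(heavyWords p c n) * c ^ n ≤ 1 := by
  rw [← sum_wordWeight p n, ← nsmul_eq_mul, ← sum_const]
  calc ∑ _S ∈ heavyWords p c n, c ^ n ≤ ∑ S ∈ heavyWords p c n, wordWeight p S n :=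
        sum_le_sum fun S hS => (mem_filter.1 hS).2
    _ ≤ _ := sum_le_sum_of_subset_of_nonneg (filter_subset _ _)
        fun S _ _ => wordWeight_nonneg h0 h1 S n

lemma sum_Icc_even (f : ℕ → ℝ) (m : ℕ) :
    ∑ k ∈ Icc 1 (2 * m), (if 2 ∣ k then f (k / 2) else 0) = ∑ k ∈ Icc 1 m, f k := by
  induction m with
  | zero => simp
  | succ m ih =>
    have h : ¬ 2 ∣ 2 * m + 1 := by omega
    have h' : 2 ∣ 2 * m + 1 + 1 := by omega
    have h'' : (2 * m + 1 + 1) / 2 = m + 1 := by omega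
    rw [show 2 * (m + 1) = 2 * m + 1 + 1 by ring, sum_Icc_succ_top (by omega),
      sum_Icc_succ_top (by omega), sum_Icc_succ_top (by omega), ih, if_neg h, if_pos h', h'']
    ring

lemma one_sub_eq_rpow {p : ℝ} (hp : p ∈ Set.Ioo (0 : ℝ) 1) (hpe : p ^ 3 = (1 - p) ^ 2) :
    1 - p = p ^ (3 / 2 : ℝ) := by
  have h : (0 : ℝ) ≤ 1 - p := by linarith [hp.2]
  rw [← Real.sqrt_sq h, ← hpe, Real.sqrt_eq_rpow, ← Real.rpow_natCast, ← Real.rpow_mul hp.1.le]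
  norm_num

lemma digitWeight_eq_rpow {p : ℝ} (hp : p ∈ Set.Ioo (0 : ℝ) 1) (hpe : p ^ 3 = (1 - p) ^ 2)
    {S : Finset ℕ} (hS : ∀ k ∈ S, 2 * k ∉ S) (k : ℕ) :
    digitWeight p S k = p ^ ((1 : ℝ) + (if k ∈ S then 1 else 0) / 2 -
      (if 2 ∣ k then (if k / 2 ∈ S then 1 else 0) else 0)) := by
  unfold digitWeight
  by_cases h : 2 ∣ k ∧ k / 2 ∈ S
  · have hk : k ∉ S := by
      have := hS _ h.2
      rwa [Nat.mul_div_cancel' h.1] at this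
    simp [h, hk]
  · have h' : (if 2 ∣ k then (if k / 2 ∈ S then 1 else 0) else 0 : ℝ) = 0 := by
      split_ifs <;> tauto
    rw [if_neg h, h']
    split_ifs
    · rw [one_sub_eq_rpow hp hpe]
      norm_num
    · simp

lemma wordWeight_two_mul {p : ℝ} (hp : p ∈ Set.Ioo (0 : ℝ) 1) (hpe : p ^ 3 = (1 - p) ^ 2)
    {S : Finset ℕ} (hS : ∀ k ∈ S, 2 * k ∉ S) (m : ℕ) :
    wordWeight p S (2 * m) =
      p ^ (2 * m + #{k ∈ Icc 1 (2 * m) | k ∈ S} / 2 - #{k ∈ Icc 1 m | k ∈ S} : ℝ) := by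
  unfold wordWeight
  rw [prod_congr rfl fun k _ => digitWeight_eq_rpow hp hpe hS k,
    ← Real.rpow_sum_of_pos hp.1, sum_sub_distrib, sum_add_distrib, ← sum_div,
    sum_Icc_even fun k => if k ∈ S then 1 else 0]
  simp [filter_mem_eq_inter]

lemma exists_small_increment {u : ℕ → ℝ} {C : ℝ} (hu : ∀ j, u j ≤ C) {ε : ℝ} (hε : 0 < ε)
    (J : ℕ) : ∃ j, u (j + J + 1) ≤ u (j + J) + ε := by
  by_contra! H
  have key : ∀ m : ℕ, u J + m * ε ≤ u (m + J) := by
    intro m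
    induction m with
    | zero => simp
    | succ m ih =>
      have := H m
      rw [show m + 1 + J = m + J + 1 by ring]
      push_cast
      linarith
  obtain ⟨m, hm⟩ := exists_nat_gt ((C - u J) / ε)
  rw [div_lt_iff₀ hε] at hm
  linarith [key m, hu (m + J)]

lemma exists_onesUpTo_mem_heavyWords {p : ℝ} (hp : p ∈ Set.Ioo (0 : ℝ) 1)
    (hpe : p ^ 3 = (1 - p) ^ 2) {a : ℕ → ℕ} (ha : ∀ k, 1 ≤ k → a k * a (2 * k) = 0)
    {δ : ℝ} (hδ : 0 < δ) (J : ℕ) :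
    ∃ j, onesUpTo a (2 ^ (j + J + 1)) ∈ heavyWords p (p ^ (1 + δ)) (2 ^ (j + J + 1)) := by
  have hu : ∀ j, (#(onesUpTo a (2 ^ j)) : ℝ) / 2 ^ j ≤ 1 := by
    intro j
    rw [div_le_one (by positivity)]
    have : #(onesUpTo a (2 ^ j)) ≤ #(Icc 1 (2 ^ j)) := card_filter_le _ _
    rw [Nat.card_Icc, Nat.add_sub_cancel] at this
    exact_mod_cast this
  obtain ⟨j, hj⟩ := exists_small_increment hu (mul_pos two_pos hδ) J
  refine ⟨j, mem_filter.2 ⟨mem_powerset.2 (filter_subset _ _), ?_⟩⟩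
  generalize j + J = i at hj ⊢
  have hS : ∀ k ∈ onesUpTo a (2 ^ (i + 1)), 2 * k ∉ onesUpTo a (2 ^ (i + 1)) := by
    intro k hk hk'
    simp only [onesUpTo, mem_filter, mem_Icc] at hk hk'
    simpa [hk.2, hk'.2] using ha k hk.1.1
  have e1 : ({k ∈ Icc 1 (2 * 2 ^ i) | k ∈ onesUpTo a (2 ^ (i + 1))} : Finset ℕ) =
      onesUpTo a (2 ^ (i + 1)) := by
    ext k
    simp only [onesUpTo, mem_filter, mem_Icc, pow_succ']
    tauto
  have e2 : ({k ∈ Icc 1 (2 ^ i) | k ∈ onesUpTo a (2 ^ (i + 1))} : Finset ℕ) =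
      onesUpTo a (2 ^ i) := by
    ext k
    simp only [onesUpTo, mem_filter, mem_Icc, pow_succ']
    constructor
    · tauto
    · rintro ⟨h, h'⟩
      exact ⟨h, ⟨h.1, by omega⟩, h'⟩
  rw [pow_succ' 2 i] at hS e1 e2 hj ⊢
  rw [wordWeight_two_mul hp hpe hS, e1, e2, ← Real.rpow_natCast, ← Real.rpow_mul hp.1.le]
  refine Real.rpow_le_rpow_of_exponent_ge hp.1 hp.2.le ?_
  have h2 : (0 : ℝ) < 2 ^ i := by positivity
  rw [pow_succ' 2 i, div_le_iff₀ (by positivity), add_mul, mul_left_comm _ 2,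
    div_mul_cancel₀ _ h2.ne'] at hj
  push_cast at hj ⊢
  linarith

lemma onesUpTo_succ (a : ℕ → ℕ) (n : ℕ) :
    onesUpTo a (n + 1) =
      if a (n + 1) = 1 then insert (n + 1) (onesUpTo a n) else onesUpTo a n := by
  rw [onesUpTo, Icc_one_succ_eq_insert, filter_insert]
  rfl

lemma dyadicPoint_onesUpTo {a : ℕ → ℕ} (ha : ∀ k, 1 ≤ k → a k ≤ 1) (n : ℕ) :
    dyadicPoint (onesUpTo a n) = ∑ k ∈ range n, (a (k + 1) : ℝ) / 2 ^ (k + 1) := by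
  induction n with
  | zero => simp [dyadicPoint, onesUpTo]
  | succ n ih =>
    rw [sum_range_succ, ← ih, onesUpTo_succ]
    have hn : n + 1 ∉ onesUpTo a n := by simp [onesUpTo]
    have := ha (n + 1) (by omega)
    interval_cases h : a (n + 1)
    · simp
    · simp [dyadicPoint, sum_insert hn, add_comm]

lemma tsum_digits_mem_Icc {a : ℕ → ℕ} (ha : ∀ k, 1 ≤ k → a k ≤ 1) (n : ℕ) :
    ∑' k : ℕ, (a (k + 1) : ℝ) / 2 ^ (k + 1) ∈
      Set.Icc (dyadicPoint (onesUpTo a n)) (dyadicPoint (onesUpTo a n) + (1 / 2) ^ n) := by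
  have hle : ∀ k, (a (k + 1) : ℝ) / 2 ^ (k + 1) ≤ 1 / 2 / 2 ^ k := by
    intro k
    have : (a (k + 1) : ℝ) ≤ 1 := by exact_mod_cast ha (k + 1) (by omega)
    rw [div_div, ← pow_succ']
    gcongr
  have hs : Summable fun k : ℕ => (a (k + 1) : ℝ) / 2 ^ (k + 1) :=
    Summable.of_nonneg_of_le (fun k => by positivity) hle (summable_geometric_two' 1)
  rw [dyadicPoint_onesUpTo ha, ← hs.sum_add_tsum_nat_add n]
  have htail : ∑' k : ℕ, (a (k + n + 1) : ℝ) / 2 ^ (k + n + 1) ≤ (1 / 2) ^ n := by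
    rw [← tsum_geometric_two' ((1 / 2 : ℝ) ^ n)]
    refine Summable.tsum_le_tsum (fun k => (hle (k + n)).trans_eq ?_)
      ((summable_nat_add_iff n).2 hs) (summable_geometric_two' _)
    rw [pow_add, one_div, inv_pow]
    field_simp
  have hpos : 0 ≤ ∑' k : ℕ, (a (k + n + 1) : ℝ) / 2 ^ (k + n + 1) :=
    tsum_nonneg fun k => by positivity
  constructor <;> linarith

lemma dimH_XiG_le_of_heavyWords {p c : ℝ} (h0 : 0 ≤ p) (h1 : p ≤ 1) (hc : 0 < c) {t : NNReal}
    (hct : (1 / 2 : ℝ) ^ (t : ℝ) < c)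
    (hcover : ∀ a : ℕ → ℕ, (∀ k, 1 ≤ k → a k * a (2 * k) = 0) → ∀ J : ℕ,
      ∃ j, onesUpTo a (2 ^ (j + J + 1)) ∈ heavyWords p c (2 ^ (j + J + 1))) :
    dimH XiG ≤ t := by
  set ρ : ℝ := (1 / 2 : ℝ) ^ (t : ℝ) / c
  have hρ0 : 0 ≤ ρ := by positivity
  have hρ1 : ρ < 1 := (div_lt_one hc).2 hct
  have hbound : ∑' j : ℕ, ENNReal.ofReal (ρ ^ j) ≠ ∞ := by
    rw [← ENNReal.ofReal_tsum_of_nonneg (fun j => pow_nonneg hρ0 j)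
      (summable_geometric_of_lt_one hρ0 hρ1)]
    exact ENNReal.ofReal_ne_top
  refine dimH_le_of_hausdorffMeasure_ne_top (ne_top_of_le_ne_top hbound ?_)
  let I : (J : ℕ) → (Σ j : ℕ, heavyWords p c (2 ^ (j + J + 1))) → Set ℝ := fun J i =>
    Set.Icc (dyadicPoint i.2.1) (dyadicPoint i.2.1 + (1 / 2) ^ 2 ^ (i.1 + J + 1))
  have hI : ∀ J i, Metric.ediam (I J i) = ENNReal.ofReal ((1 / 2) ^ 2 ^ (i.1 + J + 1)) := by
    intro J i
    simp only [I, Real.ediam_Icc, add_sub_cancel_left]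
  have hsum : ∀ J, ∑' i, Metric.ediam (I J i) ^ (t : ℝ) ≤ ∑' j : ℕ, ENNReal.ofReal (ρ ^ j) := by
    intro J
    rw [ENNReal.tsum_sigma']
    refine ENNReal.tsum_le_tsum fun j => ?_
    set n := 2 ^ (j + J + 1) with hn
    have hjn : j ≤ n := by
      have := (Nat.lt_two_pow_self : j + J + 1 < 2 ^ (j + J + 1))
      omega
    simp only [hI, ← hn, tsum_fintype, sum_const, card_univ, Fintype.card_coe, nsmul_eq_mul]
    rw [ENNReal.ofReal_rpow_of_nonneg (by positivity) t.coe_nonneg, ← ENNReal.ofReal_natCast,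
      ← ENNReal.ofReal_mul (by positivity)]
    refine ENNReal.ofReal_le_ofReal ?_
    calc (#(heavyWords p c n) : ℝ) * ((1 / 2 : ℝ) ^ n) ^ (t : ℝ)
        = (#(heavyWords p c n) * c ^ n) * ρ ^ n := by
          rw [← Real.rpow_pow_comm (by norm_num), mul_assoc, ← mul_pow, mul_div_cancel₀ _ hc.ne']
      _ ≤ 1 * ρ ^ n := by gcongr; exact card_heavyWords_mul_le h0 h1 c n
      _ ≤ ρ ^ j := by rw [one_mul]; exact pow_le_pow_of_le_one hρ0 hρ1.le hjn
  have hr : Tendsto (fun J : ℕ => ENNReal.ofReal ((1 / 2) ^ J)) atTop (𝓝 0) := by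
    have := ENNReal.tendsto_ofReal
      (tendsto_pow_atTop_nhds_zero_of_lt_one (by norm_num : (0 : ℝ) ≤ 1 / 2) (by norm_num))
    simpa only [ENNReal.ofReal_zero] using this
  refine (Measure.hausdorffMeasure_le_liminf_tsum _ XiG _ hr I
    (Eventually.of_forall fun J i => ?_) (Eventually.of_forall fun J x hx => ?_)).trans
    ((liminf_le_liminf (Eventually.of_forall hsum)).trans_eq (liminf_const _))
  · rw [hI]
    refine ENNReal.ofReal_le_ofReal (pow_le_pow_of_le_one (by norm_num) (by norm_num) ?_)
    have := (Nat.lt_two_pow_self : i.1 + J + 1 < 2 ^ (i.1 + J + 1))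
    omega
  · obtain ⟨a, ha1, ha2, rfl⟩ := hx
    obtain ⟨j, hj⟩ := hcover a ha2 J
    exact Set.mem_iUnion.2 ⟨⟨j, _, hj⟩, tsum_digits_mem_Icc ha1 _⟩

lemma dimH_XiG_le {p : ℝ} (hp : p ∈ Set.Ioo (0 : ℝ) 1) (hpe : p ^ 3 = (1 - p) ^ 2) {t : ℝ}
    (ht : -Real.logb 2 p < t) : dimH XiG ≤ ENNReal.ofReal t := by
  have hs : Real.logb 2 p < 0 := Real.logb_neg one_lt_two hp.1 hp.2
  lift t to NNReal using by linarith
  obtain ⟨r, hr1, hr⟩ := exists_between ((one_lt_div (neg_pos.2 hs)).2 ht)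
  rw [lt_div_iff₀ (neg_pos.2 hs)] at hr
  rw [ENNReal.ofReal_coe_nnreal]
  refine dimH_XiG_le_of_heavyWords hp.1.le hp.2.le (Real.rpow_pos_of_pos hp.1 (1 + (r - 1))) ?_
    fun a ha J => exists_onesUpTo_mem_heavyWords hp hpe ha (sub_pos.2 hr1) J
  rw [← Real.logb_lt_logb_iff one_lt_two (by positivity) (Real.rpow_pos_of_pos hp.1 _),
    Real.logb_rpow_eq_mul_logb_of_pos (by norm_num), Real.logb_rpow_eq_mul_logb_of_pos hp.1,
    one_div, Real.logb_inv, Real.logb_self_eq_one one_lt_two]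
  linarith

lemma F_pos : ∀ n, 0 < F n
  | 0 => one_pos
  | 1 => one_pos
  | n + 2 => Nat.add_pos_left (F_pos n) _

lemma F_le_two_pow : ∀ n, F n ≤ 2 ^ n
  | 0 => le_rfl
  | 1 => one_le_two
  | n + 2 => by
    have h0 := F_le_two_pow n
    have h1 := F_le_two_pow (n + 1)
    rw [F]
    rw [pow_succ] at h1 ⊢
    rw [pow_succ]
    omega

lemma logb_F_nonneg (n : ℕ) : 0 ≤ Real.logb 2 (F n) :=
  Real.logb_nonneg one_lt_two (by exact_mod_cast F_pos n)

lemma logb_F_le (n : ℕ) : Real.logb 2 (F n) ≤ n := by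
  rw [Real.logb_le_iff_le_rpow one_lt_two (by exact_mod_cast F_pos n), Real.rpow_natCast]
  exact_mod_cast F_le_two_pow n

lemma summable_logb_F : Summable fun k : ℕ => Real.logb 2 (F (k + 2)) / 2 ^ (k + 2) := by
  have h : Summable fun n : ℕ => (n : ℝ) / 2 ^ n := by
    have := summable_pow_mul_geometric_of_norm_lt_one 1
      (by norm_num : ‖(1 / 2 : ℝ)‖ < 1)
    simpa [div_eq_mul_inv] using this
  refine Summable.of_nonneg_of_le (fun k => div_nonneg (logb_F_nonneg _) (by positivity))
    (fun k => ?_) ((summable_nat_add_iff 2).2 h)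
  gcongr
  exact logb_F_le _

lemma lt_of_cube_eq {p : ℝ} (hp : p ∈ Set.Ioo (0 : ℝ) 1) (hpe : p ^ 3 = (1 - p) ^ 2) :
    569 / 1000 < p := by
  by_contra! h
  have h3 : p ^ 3 ≤ (569 / 1000) ^ 3 := pow_le_pow_left₀ hp.1.le h 3
  have h2 : (1 - 569 / 1000) ^ 2 ≤ (1 - p) ^ 2 := pow_le_pow_left₀ (by norm_num) (by linarith) 2
  norm_num at h3 h2
  linarith

set_option exponentiation.threshold 1024 in
lemma neg_logb_lt_tsum {p : ℝ} (hp : p ∈ Set.Ioo (0 : ℝ) 1) (hpe : p ^ 3 = (1 - p) ^ 2) :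
    -Real.logb 2 p < ∑' k : ℕ, Real.logb 2 (F (k + 2)) / 2 ^ (k + 2) := by
  refine lt_of_lt_of_le ?_ (summable_logb_F.sum_le_tsum (range 9)
    fun k _ => div_nonneg (logb_F_nonneg _) (by positivity))
  have hlog : Real.logb 2 (569 / 1000) < Real.logb 2 p :=
    Real.logb_lt_logb one_lt_two (by norm_num) (lt_of_cube_eq hp hpe)
  have key : 0 < Real.logb 2 ((569 / 1000) ^ 1024 * 2 ^ 256 * 3 ^ 128 * 5 ^ 64 * 8 ^ 32 *
      13 ^ 16 * 21 ^ 8 * 34 ^ 4 * 55 ^ 2 * 89) :=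
    Real.logb_pos one_lt_two (by norm_num)
  repeat rw [Real.logb_mul (by positivity) (by positivity)] at key
  simp only [Real.logb_pow] at key
  simp only [sum_range_succ, sum_range_zero, F]
  norm_num at key ⊢
  linarith

end

/-- `-log₂ p < ∑_{k ≥ 1} 2^{-(k+1)} log₂ F_{k+1}`: the Hausdorff dimension `-log₂ p` of the
multiplicative golden mean shift is strictly smaller than its Minkowski dimension
`∑_{k ≥ 1} 2^{-(k+1)} log₂ F_{k+1}`. -/
theorem hausdorff_lt_minkowski (p : ℝ) (hp : p ∈ Set.Ioo (0 : ℝ) 1)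
    (hpe : p ^ 3 = (1 - p) ^ 2) :
    -Real.logb 2 p < ∑' k : ℕ, Real.logb 2 (F (k + 2)) / 2 ^ (k + 2) ∧
    dimH XiG < ENNReal.ofReal (∑' k : ℕ, Real.logb 2 (F (k + 2)) / 2 ^ (k + 2)) := by
  have hlt := neg_logb_lt_tsum hp hpe
  obtain ⟨t, ht, htM⟩ := exists_between hlt
  have ht0 : 0 < t := (neg_pos.2 (Real.logb_neg one_lt_two hp.1 hp.2)).trans ht
  exact ⟨hlt, (dimH_XiG_le hp hpe ht).trans_lt
    ((ENNReal.ofReal_lt_ofReal_iff (ht0.trans htM)).2 htM)⟩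
end

section
/- Let p be the unique real number in (0,1) satisfying p^3 = (1-p)^2. Then the Hausdorff dimension of the symbolic multiplicative golden mean shift X_G, as a subset of the metric space (Σ₂, ρ), equals -log₂ p. -/
open scoped ENNReal
open Filter MeasureTheory

/-- The space `Σ₂ = {0,1}^ℕ` of binary sequences indexed by the positive integers:
a point `x : SigmaTwo` represents the sequence `(x_k)_{k ≥ 1}` with `x_k = x (k - 1)`. -/
def SigmaTwo : Type := ℕ → Fin 2

namespace SigmaTwo

/-- Reinterpret a point of `Σ₂` as a bare sequence. -/
def toSeq (x : SigmaTwo) : ℕ → Fin 2 := x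

attribute [local instance] PiNat.dist

open Classical in
/-- The metric `ρ(x,y) = 2^{-min{n ≥ 1 : x_n ≠ y_n}}`: in the 0-indexed representation the
least positive-integer index (`≥ 1`) where `x` and `y` differ is `PiNat.firstDiff x y + 1`. -/
noncomputable def rho (x y : SigmaTwo) : ℝ :=
  if x = y then 0 else (2 : ℝ) ^ (-((PiNat.firstDiff (toSeq x) (toSeq y) : ℤ) + 1))

theorem rho_eq_dist_div_two (x y : SigmaTwo) : rho x y = dist (toSeq x) (toSeq y) / 2 := by
  rcases eq_or_ne x y with rfl | h
  · have : dist (toSeq x) (toSeq x) = 0 := PiNat.dist_self _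
    rw [rho, if_pos rfl, this]; norm_num
  · have h' : toSeq x ≠ toSeq y := h
    rw [rho, if_neg h, PiNat.dist_eq_of_ne h']
    rw [zpow_neg, zpow_add₀ (by norm_num : (2:ℝ) ≠ 0), zpow_natCast, zpow_one, mul_inv,
      one_div, inv_pow]
    ring

theorem rho_self (x : SigmaTwo) : rho x x = 0 := by
  rw [rho_eq_dist_div_two, PiNat.dist_self]; norm_num

theorem rho_comm (x y : SigmaTwo) : rho x y = rho y x := by
  rw [rho_eq_dist_div_two, rho_eq_dist_div_two, PiNat.dist_comm]

theorem rho_triangle (x y z : SigmaTwo) : rho x z ≤ rho x y + rho y z := by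
  rw [rho_eq_dist_div_two, rho_eq_dist_div_two, rho_eq_dist_div_two]
  have := PiNat.dist_triangle (toSeq x) (toSeq y) (toSeq z)
  linarith

theorem rho_eq_zero {x y : SigmaTwo} (h : rho x y = 0) : x = y := by
  rw [rho_eq_dist_div_two] at h
  exact PiNat.eq_of_dist_eq_zero (toSeq x) (toSeq y) (by linarith)

/-- `Σ₂` equipped with the metric `ρ`. -/
noncomputable instance : MetricSpace SigmaTwo where
  dist := rho
  dist_self := rho_self
  dist_comm := rho_comm
  dist_triangle := rho_triangle
  eq_of_dist_eq_zero := rho_eq_zero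

noncomputable instance : MeasurableSpace SigmaTwo := borel SigmaTwo

instance : BorelSpace SigmaTwo := ⟨rfl⟩

/-- The symbolic multiplicative golden mean shift
`X_G = {(x_k) : x_k x_{2k} = 0 for all k ≥ 1}`. -/
def XG : Set SigmaTwo :=
  {x | ∀ k : ℕ, 1 ≤ k → (x (k - 1) : ℕ) * (x (2 * k - 1) : ℕ) = 0}

/-- The (additive) golden mean shift `Σ_G = {(x_k) : x_k x_{k+1} = 0 for all k ≥ 1}`. -/
def SigmaG : Set SigmaTwo :=
  {x | ∀ k : ℕ, 1 ≤ k → (x (k - 1) : ℕ) * (x k : ℕ) = 0}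

/-- The cylinder `[x_1 … x_n]`: all sequences agreeing with `x` in coordinates `1, …, n`. -/
def cylinder (x : SigmaTwo) (n : ℕ) : Set SigmaTwo := {y | ∀ i : ℕ, i < n → y i = x i}

open Finset in
/-- The number of ones among the first `n` coordinates of `x`. -/
noncomputable def ones (n : ℕ) (x : ℕ → Fin 2) : ℝ := ∑ k ∈ range n, ((x k : ℕ) : ℝ)

/-- The indicator of the event that coordinate `k` is forced to vanish by an earlier one. -/
noncomputable def blocked (x : ℕ → Fin 2) (k : ℕ) : ℝ :=
  if Even k then 0 else ((x (k / 2) : ℕ) : ℝ)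

/-- The transition probability of coordinate `k` given the previous ones: a coordinate which is
not forced to vanish is `0` with probability `p` and `1` with probability `1 - p`. -/
noncomputable def transition (p : ℝ) (x : ℕ → Fin 2) (k : ℕ) : ℝ :=
  if Even k ∨ x (k / 2) = 0 then (if x k = 0 then p else 1 - p) else if x k = 0 then 1 else 0

open Finset in
/-- The probability of the cylinder of length `n` around `x`. -/
noncomputable def weight (p : ℝ) (n : ℕ) (x : ℕ → Fin 2) : ℝ := ∏ k ∈ range n, transition p x k

/-- Extend a finite word by zeros. -/
def extendZero {n : ℕ} (w : Fin n → Fin 2) (k : ℕ) : Fin 2 := if h : k < n then w ⟨k, h⟩ else 0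

theorem extendZero_restrict {n k : ℕ} (x : ℕ → Fin 2) (hk : k < n) :
    extendZero (fun i : Fin n => x i) k = x k := by
  simp [extendZero, hk]

theorem extendZero_snoc {n : ℕ} (w : Fin n → Fin 2) (b : Fin 2) :
    extendZero (Fin.snoc w b : Fin (n + 1) → Fin 2) = Function.update (extendZero w) n b := by
  funext k
  rcases lt_trichotomy k n with h | h | h
  · have h1 : k < n + 1 := by omega
    simp [extendZero, h, h1, Fin.snoc, Function.update_of_ne h.ne]
  · subst h
    simp [extendZero, Fin.snoc]
  · have h1 : ¬ k < n + 1 := by omega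
    have h2 : ¬ k < n := by omega
    simp [extendZero, h1, h2, Function.update_of_ne h.ne']

theorem sum_word_succ (n : ℕ) (F : (ℕ → Fin 2) → ℝ) :
    ∑ w : Fin (n + 1) → Fin 2, F (extendZero w) =
      ∑ w : Fin n → Fin 2,
        (F (Function.update (extendZero w) n 0) + F (Function.update (extendZero w) n 1)) := by
  rw [← (Fin.snocEquiv (fun _ => Fin 2)).sum_comp, Fintype.sum_prod_type, Finset.sum_comm]
  refine Finset.sum_congr rfl fun w _ => ?_
  rw [Fin.sum_univ_two]
  rw [← extendZero_snoc, ← extendZero_snoc]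
  rfl

open Finset in
theorem sum_word_prod_le (F : ℕ → (ℕ → Fin 2) → ℝ) (c : ℝ) (h0 : ∀ k x, 0 ≤ F k x)
    (hdep : ∀ k x y, (∀ i ≤ k, x i = y i) → F k x = F k y)
    (hc : ∀ k x, F k (Function.update x k 0) + F k (Function.update x k 1) ≤ c) (n : ℕ) :
    ∑ w : Fin n → Fin 2, ∏ k ∈ range n, F k (extendZero w) ≤ c ^ n := by
  have hc0 : 0 ≤ c := (add_nonneg (h0 0 _) (h0 0 _)).trans (hc 0 fun _ => 0)
  induction n with
  | zero => simp
  | succ n ih =>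
    rw [sum_word_succ n fun x => ∏ k ∈ range (n + 1), F k x, pow_succ]
    refine le_trans ?_ (mul_le_mul_of_nonneg_right ih hc0)
    rw [sum_mul]
    refine sum_le_sum fun w _ => ?_
    have key : ∀ b : Fin 2, ∏ k ∈ range n, F k (Function.update (extendZero w) n b) =
        ∏ k ∈ range n, F k (extendZero w) := fun b => prod_congr rfl fun k hk =>
      hdep _ _ _ fun i hi => Function.update_of_ne (by have := mem_range.1 hk; omega) _ _
    rw [prod_range_succ, prod_range_succ, key, key, ← mul_add]
    exact mul_le_mul_of_nonneg_left (hc _ _) (prod_nonneg fun k _ => h0 _ _)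

theorem transition_congr (p : ℝ) (k : ℕ) (x y : ℕ → Fin 2) (h : ∀ i ≤ k, x i = y i) :
    transition p x k = transition p y k := by
  simp only [transition, h k le_rfl, h (k / 2) (Nat.div_le_self _ _)]

theorem blocked_congr (k : ℕ) (x y : ℕ → Fin 2) (h : ∀ i ≤ k, x i = y i) :
    blocked x k = blocked y k := by
  simp only [blocked, h (k / 2) (Nat.div_le_self _ _)]

theorem weight_congr (p : ℝ) (n : ℕ) (x y : ℕ → Fin 2) (h : ∀ i < n, x i = y i) :
    weight p n x = weight p n y :=
  Finset.prod_congr rfl fun k hk => transition_congr p k x y fun i hi =>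
    h i (by have := Finset.mem_range.1 hk; omega)

theorem ones_congr (n : ℕ) (x y : ℕ → Fin 2) (h : ∀ i < n, x i = y i) : ones n x = ones n y :=
  Finset.sum_congr rfl fun k hk => by rw [h k (Finset.mem_range.1 hk)]

theorem transition_nonneg {p : ℝ} (hp : p ∈ Set.Ioo (0 : ℝ) 1) (k : ℕ) (x : ℕ → Fin 2) :
    0 ≤ transition p x k := by
  have := hp.1
  have := hp.2
  unfold transition
  split_ifs <;> linarith

theorem weight_nonneg {p : ℝ} (hp : p ∈ Set.Ioo (0 : ℝ) 1) (n : ℕ) (x : ℕ → Fin 2) :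
    0 ≤ weight p n x := Finset.prod_nonneg fun k _ => transition_nonneg hp k x

theorem div_two_ne_of_not_even {k : ℕ} (hk : ¬ Even k) : k / 2 ≠ k := by
  intro h
  have : k = 0 := by omega
  exact hk (by simp [this])

theorem sum_word_weight_le {p : ℝ} (hp : p ∈ Set.Ioo (0 : ℝ) 1) (n : ℕ) :
    ∑ w : Fin n → Fin 2, weight p n (extendZero w) ≤ 1 := by
  have := sum_word_prod_le (fun k x => transition p x k) 1 (fun k x => transition_nonneg hp k x)
    (transition_congr p) (fun k x => ?_) n
  · rwa [one_pow] at this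
  · by_cases hk : Even k
    · simp [transition, hk]
    · have h2 := div_two_ne_of_not_even hk
      simp only [transition, hk, Function.update_of_ne h2]
      split_ifs <;> simp_all

theorem sum_word_weight_mul_exp_le {p : ℝ} (hp : p ∈ Set.Ioo (0 : ℝ) 1) {t : ℝ} (ht : |t| ≤ 1)
    (n : ℕ) :
    ∑ w : Fin n → Fin 2, weight p n (extendZero w) * Real.exp (t * ∑ k ∈ Finset.range n,
      (((extendZero w k : ℕ) : ℝ) - (1 - p) * (1 - blocked (extendZero w) k))) ≤
      Real.exp (t ^ 2) ^ n := by
  have hp0 := hp.1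
  have hp1 := hp.2
  have := sum_word_prod_le (fun k x => transition p x k *
    Real.exp (t * (((x k : ℕ) : ℝ) - (1 - p) * (1 - blocked x k)))) (Real.exp (t ^ 2))
    (fun k x => mul_nonneg (transition_nonneg hp k x) (Real.exp_pos _).le)
    (fun k x y h => by
      simp only [transition_congr p k x y h, blocked_congr k x y h, h k le_rfl]) (fun k x => ?_) n
  · refine le_of_eq_of_le ?_ this
    refine Finset.sum_congr rfl fun w _ => ?_
    rw [Finset.prod_mul_distrib, ← Real.exp_sum, ← Finset.mul_sum]
    rfl
  · have free : p * Real.exp (t * (0 - (1 - p))) + (1 - p) * Real.exp (t * (1 - (1 - p))) ≤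
        Real.exp (t ^ 2) := by
      have hb := abs_le.1 ht
      have e1 := (abs_le.1 (Real.abs_exp_sub_one_sub_id_le (x := t * (0 - (1 - p))) (by
        rw [abs_mul]
        exact mul_le_one₀ ht (abs_nonneg _) (abs_le.2 ⟨by linarith, by linarith⟩)))).2
      have e2 := (abs_le.1 (Real.abs_exp_sub_one_sub_id_le (x := t * (1 - (1 - p))) (by
        rw [abs_mul]
        exact mul_le_one₀ ht (abs_nonneg _) (abs_le.2 ⟨by linarith, by linarith⟩)))).2
      have e3 := Real.add_one_le_exp (t ^ 2)
      have e4 := mul_le_mul_of_nonneg_left e1 hp0.le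
      have e5 := mul_le_mul_of_nonneg_left e2 (sub_nonneg.2 hp1.le)
      have e6 : t ^ 2 * (p * (1 - p)) ≤ t ^ 2 * 1 :=
        mul_le_mul_of_nonneg_left (by nlinarith) (sq_nonneg t)
      nlinarith
    have one : 1 ≤ Real.exp (t ^ 2) := Real.one_le_exp (sq_nonneg t)
    by_cases hk : Even k
    · simpa [transition, blocked, hk] using free
    · have h2 := div_two_ne_of_not_even hk
      simp only [transition, blocked, hk, Function.update_of_ne h2, Function.update_self]
      by_cases h3 : x (k / 2) = 0
      · simpa [h3] using free
      · have h4 : x (k / 2) = 1 := by omega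
        simpa [h4] using one

open Finset in
theorem sum_blocked (n : ℕ) (x : ℕ → Fin 2) : ∑ k ∈ range n, blocked x k = ones (n / 2) x := by
  induction n with
  | zero => simp [ones]
  | succ n ih =>
    rw [sum_range_succ, ih, blocked]
    split_ifs with h
    · obtain ⟨m, rfl⟩ := h
      rw [show (m + m) / 2 = m by omega, show (m + m + 1) / 2 = m by omega, add_zero]
    · obtain ⟨m, rfl⟩ := Nat.not_even_iff_odd.1 h
      rw [show (2 * m + 1) / 2 = m by omega, show (2 * m + 1 + 1) / 2 = m + 1 by omega, ones, ones,
        sum_range_succ]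

/-- The martingale counting the ones minus their conditional expectations. -/
noncomputable def deviation (p : ℝ) (n : ℕ) (x : ℕ → Fin 2) : ℝ :=
  ones n x - (1 - p) * (n - ones (n / 2) x)

theorem sum_eq_deviation (p : ℝ) (n : ℕ) (x : ℕ → Fin 2) :
    ∑ k ∈ Finset.range n, (((x k : ℕ) : ℝ) - (1 - p) * (1 - blocked x k)) = deviation p n x := by
  rw [Finset.sum_sub_distrib, ← Finset.mul_sum, Finset.sum_sub_distrib, sum_blocked]
  simp [deviation, ones]

theorem mem_XG_iff (x : SigmaTwo) : x ∈ XG ↔ ∀ k, ¬ Even k → x (k / 2) = 0 ∨ x k = 0 := by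
  constructor
  · intro h k hk
    obtain ⟨m, rfl⟩ := Nat.not_even_iff_odd.1 hk
    have := h (m + 1) (by omega)
    rw [show (2 * m + 1) / 2 = m by omega]
    rw [show 2 * (m + 1) - 1 = 2 * m + 1 by omega, Nat.add_sub_cancel, mul_eq_zero] at this
    exact this.imp (fun h => Fin.ext h) (fun h => Fin.ext h)
  · intro h k hk
    have := h (2 * k - 1) (Nat.not_even_iff_odd.2 ⟨k - 1, by omega⟩)
    rw [show (2 * k - 1) / 2 = k - 1 by omega] at this
    rw [mul_eq_zero]
    exact this.imp (fun h => by rw [h]; rfl) (fun h => by rw [h]; rfl)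

theorem log_one_sub {p : ℝ} (hpe : p ^ 3 = (1 - p) ^ 2) :
    Real.log (1 - p) = 3 / 2 * Real.log p := by
  have := congrArg Real.log hpe
  rw [Real.log_pow, Real.log_pow] at this
  push_cast at this
  linarith

theorem weight_eq {p : ℝ} (hp : p ∈ Set.Ioo (0 : ℝ) 1) (hpe : p ^ 3 = (1 - p) ^ 2) {x : ℕ → Fin 2}
    (hx : ∀ k, ¬ Even k → x (k / 2) = 0 ∨ x k = 0) (n : ℕ) :
    weight p n x = p ^ (n + ones n x / 2 - ones (n / 2) x : ℝ) := by
  have key : ∀ k, transition p x k = p ^ (1 + ((x k : ℕ) : ℝ) / 2 - blocked x k) := by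
    intro k
    have hq : 1 - p = p ^ (1 + 1 / 2 : ℝ) := by
      rw [Real.rpow_def_of_pos hp.1, ← Real.exp_log (sub_pos.2 hp.2), log_one_sub hpe]
      ring_nf
    have hxk : x k = 0 ∨ x k = 1 := by omega
    by_cases hk : Even k
    · rcases hxk with h | h
      · simp [transition, blocked, hk, h]
      · simp [transition, blocked, hk, h, hq]
    · by_cases h2 : x (k / 2) = 0
      · rcases hxk with h | h
        · simp [transition, blocked, hk, h, h2]
        · simp [transition, blocked, hk, h, h2, hq]
      · have h3 : x (k / 2) = 1 := by omega
        have h4 := (hx k hk).resolve_left h2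
        simp [transition, blocked, hk, h3, h4]
  rw [weight, Finset.prod_congr rfl fun k _ => key k, ← Real.rpow_sum_of_pos hp.1,
    Finset.sum_sub_distrib, sum_blocked, Finset.sum_add_distrib, ← Finset.sum_div]
  simp [ones]

theorem ones_nonneg (n : ℕ) (x : ℕ → Fin 2) : 0 ≤ ones n x :=
  Finset.sum_nonneg fun _ _ => Nat.cast_nonneg _

theorem ones_le (n : ℕ) (x : ℕ → Fin 2) : ones n x ≤ n := by
  have : ones n x ≤ ∑ k ∈ Finset.range n, (1 : ℝ) := Finset.sum_le_sum fun k _ => by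
    exact_mod_cast (show (x k : ℕ) ≤ 1 by omega)
  simpa using this

/-- The frequencies of ones along powers of two are bounded, so they increase by at most `ε`
infinitely often. -/
theorem exists_ones_two_pow_le (x : ℕ → Fin 2) {ε : ℝ} (hε : 0 < ε) (J : ℕ) :
    ∃ j ≥ J, ones (2 ^ (j + 1)) x / 2 - ones (2 ^ j) x ≤ ε * 2 ^ (j + 1) := by
  by_contra! H
  have step : ∀ i : ℕ, 2 * ε * i ≤ ones (2 ^ (J + i)) x / 2 ^ (J + i) := by
    intro i
    induction i with
    | zero => simpa using div_nonneg (ones_nonneg _ _) (by positivity)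
    | succ i ih =>
      have := H (J + i) (by omega)
      have h2 : (0 : ℝ) < 2 ^ (J + i) := by positivity
      rw [le_div_iff₀ h2] at ih
      rw [← add_assoc, le_div_iff₀ (by positivity)]
      rw [pow_succ] at this ⊢
      push_cast
      nlinarith
  obtain ⟨i, hi⟩ := exists_nat_gt (1 / (2 * ε))
  have h1 := step i
  have h2 : ones (2 ^ (J + i)) x / 2 ^ (J + i) ≤ 1 := by
    rw [div_le_one (by positivity)]
    simpa using ones_le (2 ^ (J + i)) x
  rw [div_lt_iff₀ (by positivity)] at hi
  linarith

/-- If the deviations are eventually at most `ε * n`, then the numbers of ones stay close to a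
linear function. -/
theorem abs_ones_sub_le {p : ℝ} (hp : p ∈ Set.Ioo (0 : ℝ) 1) {ε : ℝ} (hε : 0 < ε) {N : ℕ}
    {x : ℕ → Fin 2} (hx : ∀ n ≥ N, |deviation p n x| ≤ ε * n) (n : ℕ) :
    |ones n x - 2 * (1 - p) / (3 - p) * n| ≤ 2 * ε * n + (N + 1 / p) := by
  have hp0 := hp.1
  have hp1 := hp.2
  set c := 2 * (1 - p) / (3 - p) with hc
  have hc0 : 0 ≤ c := div_nonneg (by linarith) (by linarith)
  have hc1 : c ≤ 1 := (div_le_one (by linarith)).2 (by linarith)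
  have hfix : (1 - p) * (1 - c / 2) = c := by
    rw [hc]
    field_simp [(by linarith : (3 - p) ≠ 0)]
    ring
  induction n using Nat.strong_induction_on with
  | _ n ih =>
    have hn0 : (0 : ℝ) ≤ n := Nat.cast_nonneg n
    have hip : 0 < 1 / p := by positivity
    by_cases hn : n < N ∨ n = 0
    · have h1 := ones_nonneg n x
      have h2 := ones_le n x
      have h3 : (n : ℝ) ≤ N := by
        rcases hn with h | h
        · exact_mod_cast h.le
        · simp [h]
      have h4 : c * n ≤ n := by nlinarith
      have h5 : 0 ≤ c * n := by positivity
      have h6 : 0 ≤ ε * n := by positivity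
      rw [abs_le]
      constructor <;> linarith
    · push Not at hn
      have hd := abs_le.1 (hx n hn.1)
      have hh := abs_le.1 (ih (n / 2) (by omega))
      have hm1 : (2 : ℝ) * (n / 2 : ℕ) ≤ n := by exact_mod_cast (by omega : 2 * (n / 2) ≤ n)
      have hm2 : (n : ℝ) ≤ 2 * (n / 2 : ℕ) + 1 := by
        exact_mod_cast (by omega : n ≤ 2 * (n / 2) + 1)
      rw [deviation] at hd
      set m : ℝ := ((n / 2 : ℕ) : ℝ)
      set e := ones (n / 2) x - c * m with he
      have hone : ones n x - c * n =
          (ones n x - (1 - p) * (n - ones (n / 2) x)) - (1 - p) * e + (1 - p) * c * (n / 2 - m) := by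
        linear_combination (n : ℝ) * hfix + (1 - p) * he
      have h1 : 0 ≤ (1 - p) * c * (n / 2 - m) :=
        mul_nonneg (mul_nonneg (by linarith) hc0) (by linarith)
      have h2 : (1 - p) * c * (n / 2 - m) ≤ 1 := by
        have : (1 - p) * c ≤ 1 := mul_le_one₀ (by linarith) hc0 hc1
        nlinarith
      have hB : 2 * ε * m + (N + 1 / p) ≤ ε * n + (N + 1 / p) := by nlinarith
      have h3 : (1 - p) * (ε * n + (N + 1 / p)) + 1 ≤ ε * n + (N + 1 / p) := by
        have hpp : p * (1 / p) = 1 := by field_simp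
        have : 0 ≤ p * (ε * n + N) := by positivity
        nlinarith
      have h4 := mul_le_mul_of_nonneg_left (hh.2.trans hB) (sub_nonneg.2 hp1.le)
      have h5 := mul_le_mul_of_nonneg_left ((neg_le_neg hB).trans hh.1) (sub_nonneg.2 hp1.le)
      rw [hone, abs_le]
      constructor <;> nlinarith

theorem weight_le {p : ℝ} (hp : p ∈ Set.Ioo (0 : ℝ) 1) (hpe : p ^ 3 = (1 - p) ^ 2) {ε : ℝ}
    (hε : 0 < ε) {N : ℕ} {x : ℕ → Fin 2} (hxG : ∀ k, ¬ Even k → x (k / 2) = 0 ∨ x k = 0)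
    (hx : ∀ n ≥ N, |deviation p n x| ≤ ε * n) (n : ℕ) :
    weight p n x ≤ p ^ ((1 - 2 * ε) * n - 2 * (N + 1 / p)) := by
  have hp0 := hp.1
  have hp1 := hp.2
  rw [weight_eq hp hpe hxG]
  refine Real.rpow_le_rpow_of_exponent_ge hp.1 hp.2.le ?_
  have h1 := abs_le.1 (abs_ones_sub_le hp hε hx n)
  have h2 := abs_le.1 (abs_ones_sub_le hp hε hx (n / 2))
  have hm1 : (2 : ℝ) * (n / 2 : ℕ) ≤ n := by exact_mod_cast (by omega : 2 * (n / 2) ≤ n)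
  have hc0 : 0 ≤ 2 * (1 - p) / (3 - p) := div_nonneg (by linarith) (by linarith)
  have hip : 0 < 1 / p := by positivity
  have hN : (0 : ℝ) ≤ N := Nat.cast_nonneg N
  nlinarith [mul_le_mul_of_nonneg_left hm1 hε.le, mul_le_mul_of_nonneg_left hm1 hc0]

theorem dist_le_iff (x y : SigmaTwo) (n : ℕ) :
    dist x y ≤ (1 / 2) ^ (n + 1) ↔ ∀ i < n, y i = x i := by
  have h := PiNat.mem_cylinder_iff_dist_le (E := fun _ => Fin 2) (x := toSeq x) (y := toSeq y)
    (n := n)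
  change rho x y ≤ _ ↔ ∀ i < n, toSeq y i = toSeq x i
  rw [PiNat.dist_comm, PiNat.cylinder, Set.mem_ofPred_eq] at h
  rw [rho_eq_dist_div_two, pow_succ, h]
  constructor <;> intro h <;> linarith

theorem half_pow_rpow {p : ℝ} (hp : 0 < p) (n : ℕ) (a : ℝ) :
    ((1 / 2 : ℝ) ^ n) ^ (-Real.logb 2 p * a) = p ^ (n * a) := by
  have h2 : p = (2 : ℝ) ^ Real.logb 2 p :=
    (Real.rpow_logb (by norm_num) (by norm_num) hp).symm
  have h3 : (1 / 2 : ℝ) ^ n = (2 : ℝ) ^ (-(n : ℝ)) := by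
    rw [Real.rpow_neg (by norm_num), Real.rpow_natCast]
    simp
  rw [h3, ← Real.rpow_mul (by norm_num)]
  conv_rhs => rw [h2, ← Real.rpow_mul (by norm_num)]
  congr 1
  ring

theorem neg_logb_pos {p : ℝ} (hp : p ∈ Set.Ioo (0 : ℝ) 1) : 0 < -Real.logb 2 p :=
  neg_pos.2 (Real.logb_neg (by norm_num) hp.1 hp.2)

/-- The points of `XG` in the cylinder of a word whose weight is not too small. -/
def heavyCylinder (p ε : ℝ) {n : ℕ} (w : Fin n → Fin 2) : Set SigmaTwo :=
  {x | x ∈ XG ∧ (∀ i < n, x i = extendZero w i) ∧ p ^ (n * (1 + ε)) ≤ weight p n (extendZero w)}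

theorem ediam_heavyCylinder_le (p ε : ℝ) {n : ℕ} (w : Fin n → Fin 2) :
    Metric.ediam (heavyCylinder p ε w) ≤ ENNReal.ofReal ((1 / 2) ^ n) := by
  refine Metric.ediam_le fun x hx y hy => ?_
  rw [edist_dist]
  refine ENNReal.ofReal_le_ofReal (le_trans ((dist_le_iff x y n).2 fun i hi => ?_)
    (pow_le_pow_of_le_one (by norm_num) (by norm_num) n.le_succ))
  rw [hx.2.1 i hi, hy.2.1 i hi]

theorem ediam_heavyCylinder_rpow_le {p ε : ℝ} (hp : p ∈ Set.Ioo (0 : ℝ) 1) (hε : 0 < ε) {n : ℕ}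
    (w : Fin n → Fin 2) :
    Metric.ediam (heavyCylinder p ε w) ^ (-Real.logb 2 p * (1 + 2 * ε)) ≤
      ENNReal.ofReal (weight p n (extendZero w) * (p ^ ε) ^ n) := by
  have hd : 0 < -Real.logb 2 p * (1 + 2 * ε) := mul_pos (neg_logb_pos hp) (by linarith)
  rcases (heavyCylinder p ε w).eq_empty_or_nonempty with h | ⟨x, hx⟩
  · rw [h, Metric.ediam_empty, ENNReal.zero_rpow_of_pos hd]
    exact zero_le
  · refine (ENNReal.rpow_le_rpow (ediam_heavyCylinder_le p ε w) hd.le).trans ?_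
    rw [ENNReal.ofReal_rpow_of_pos (by positivity), half_pow_rpow hp.1]
    refine ENNReal.ofReal_le_ofReal ?_
    rw [show (n : ℝ) * (1 + 2 * ε) = n * (1 + ε) + ε * n by ring, Real.rpow_add hp.1,
      Real.rpow_mul hp.1.le ε, Real.rpow_natCast]
    exact mul_le_mul_of_nonneg_right hx.2.2 (pow_nonneg (Real.rpow_nonneg hp.1.le _) _)

theorem dimH_XG_le {p ε : ℝ} (hp : p ∈ Set.Ioo (0 : ℝ) 1) (hpe : p ^ 3 = (1 - p) ^ 2)
    (hε : 0 < ε) : dimH XG ≤ ENNReal.ofReal (-Real.logb 2 p * (1 + 2 * ε)) := by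
  have hd : 0 < -Real.logb 2 p * (1 + 2 * ε) := mul_pos (neg_logb_pos hp) (by linarith)
  refine dimH_le_of_hausdorffMeasure_ne_top (d := (-Real.logb 2 p * (1 + 2 * ε)).toNNReal) ?_
  rw [Real.coe_toNNReal _ hd.le]
  set q := p ^ ε with hq
  have hq0 : 0 < q := Real.rpow_pos_of_pos hp.1 _
  have hq1 : q < 1 := Real.rpow_lt_one hp.1.le hp.2 hε
  have hn : ∀ i : ℕ, i ≤ 2 ^ (i + 1) := fun i =>
    (Nat.lt_two_pow_self.trans_le (Nat.pow_le_pow_right (by norm_num) i.le_succ)).le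
  have H := Measure.hausdorffMeasure_le_liminf_tsum (β := ℕ)
    (ι := fun J => Σ j : ℕ, (Fin (2 ^ (J + j + 1)) → Fin 2)) (-Real.logb 2 p * (1 + 2 * ε)) XG
    (l := atTop) (fun J => ENNReal.ofReal ((1 / 2) ^ J)) ?_
    (fun J i => heavyCylinder p ε i.2) (Eventually.of_forall fun J i => ?_)
    (Eventually.of_forall fun J x hx => ?_)
  · refine ne_top_of_le_ne_top ?_ (H.trans (liminf_le_of_frequently_le'
      (x := (1 - ENNReal.ofReal q)⁻¹) (Frequently.of_forall fun J => ?_)))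
    · rw [Ne, ENNReal.inv_eq_top, tsub_eq_zero_iff_le, not_le]
      exact ENNReal.ofReal_lt_one.2 hq1
    · rw [← ENNReal.tsum_geometric, ENNReal.tsum_sigma']
      refine ENNReal.tsum_le_tsum fun j => ?_
      rw [tsum_fintype]
      refine (Finset.sum_le_sum fun w _ => ediam_heavyCylinder_rpow_le hp hε w).trans ?_
      rw [← ENNReal.ofReal_sum_of_nonneg fun w _ =>
        mul_nonneg (weight_nonneg hp _ _) (pow_nonneg hq0.le _), ← Finset.sum_mul,
        ← ENNReal.ofReal_pow hq0.le]
      refine ENNReal.ofReal_le_ofReal ?_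
      calc _ ≤ 1 * q ^ (2 ^ (J + j + 1)) :=
            mul_le_mul_of_nonneg_right (sum_word_weight_le hp _) (pow_nonneg hq0.le _)
        _ ≤ q ^ j := by
            rw [one_mul]
            exact pow_le_pow_of_le_one hq0.le hq1.le (by have := hn (J + j); omega)
  · rw [← ENNReal.ofReal_zero]
    exact ENNReal.tendsto_ofReal
      (tendsto_pow_atTop_nhds_zero_of_lt_one (by norm_num) (by norm_num))
  · exact (ediam_heavyCylinder_le p ε i.2).trans (ENNReal.ofReal_le_ofReal
      (pow_le_pow_of_le_one (by norm_num) (by norm_num) (by have := hn (J + i.1); omega)))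
  · obtain ⟨j, hj, hjx⟩ := exists_ones_two_pow_le (toSeq x) hε J
    obtain ⟨i, rfl⟩ := Nat.exists_eq_add_of_le hj
    have hw : ∀ k < 2 ^ (J + i + 1),
        extendZero (fun a : Fin (2 ^ (J + i + 1)) => toSeq x a) k = toSeq x k :=
      fun k hk => extendZero_restrict _ hk
    refine Set.mem_iUnion.2 ⟨⟨i, fun a => toSeq x a⟩, hx, fun k hk => (hw k hk).symm, ?_⟩
    rw [weight_congr p _ _ (toSeq x) hw, weight_eq hp hpe (x := toSeq x) ((mem_XG_iff x).1 hx)]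
    refine Real.rpow_le_rpow_of_exponent_ge hp.1 hp.2.le ?_
    rw [show 2 ^ (J + i + 1) / 2 = 2 ^ (J + i) by rw [pow_succ]; simp]
    push_cast
    linarith

theorem isLocallyConstant_apply (k : ℕ) : IsLocallyConstant fun x : SigmaTwo => x k := by
  rw [IsLocallyConstant.iff_eventually_eq]
  intro x
  filter_upwards [Metric.ball_mem_nhds x (show (0 : ℝ) < (1 / 2) ^ (k + 1 + 1) by positivity)]
    with y hy
  rw [Metric.mem_ball, dist_comm] at hy
  exact (dist_le_iff x y (k + 1)).1 hy.le k k.lt_succ_self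

theorem measurable_apply (k : ℕ) : Measurable fun x : SigmaTwo => x k :=
  (isLocallyConstant_apply k).continuous.measurable

/-- Reinterpret a bare sequence as a point of `Σ₂`. -/
def ofSeq (y : ℕ → Fin 2) : SigmaTwo := y

theorem continuous_ofSeq : Continuous ofSeq := by
  refine continuous_def.2 fun s hs => (PiNat.isOpen_iff_dist _).2 fun x hx => ?_
  obtain ⟨ε, hε, h⟩ := Metric.isOpen_iff.1 hs (ofSeq x) hx
  refine ⟨ε, hε, fun y hy => h ?_⟩
  refine Metric.mem_ball'.2 ?_
  change rho (ofSeq x) (ofSeq y) < ε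
  rw [rho_eq_dist_div_two]
  change dist (toSeq (ofSeq x)) (toSeq (ofSeq y)) < ε at hy
  linarith [show 0 < ε from hε]

theorem measurable_deviation (p : ℝ) (n : ℕ) :
    Measurable fun x : SigmaTwo => deviation p n (toSeq x) := by
  have h : ∀ n, Measurable fun x : SigmaTwo => ones n (toSeq x) := fun n =>
    Finset.measurable_sum _ fun k _ =>
      (measurable_of_countable fun b : Fin 2 => ((b : ℕ) : ℝ)).comp (measurable_apply k)
  exact (h n).sub ((measurable_const.sub (h _)).const_mul _)

theorem measurableSet_XG : MeasurableSet XG := by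
  have : XG = ⋂ k : ℕ, {x | ¬ Even k → x (k / 2) = 0 ∨ x k = 0} := by
    ext x
    rw [Set.mem_iInter]
    exact mem_XG_iff x
  rw [this]
  refine MeasurableSet.iInter fun k => ?_
  by_cases hk : Even k
  · simp [hk]
  · simp only [hk, not_false_eq_true, true_imp_iff]
    exact (measurable_apply (k / 2) (measurableSet_singleton 0)).union
      (measurable_apply k (measurableSet_singleton 0))

theorem measurableSet_cylinder (x : SigmaTwo) (n : ℕ) : MeasurableSet (cylinder x n) := by
  have : cylinder x n = ⋂ i : ℕ, ⋂ _ : i < n, {y | y i = x i} := by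
    ext y
    simp [cylinder]
  rw [this]
  exact MeasurableSet.iInter fun i => MeasurableSet.iInter fun _ =>
    measurable_apply i (measurableSet_singleton (x i))

/-- The law of a coin showing `0` with probability `p` and `1` with probability `1 - p`. -/
noncomputable def coin (p : ℝ) : Measure (Fin 2) :=
  ENNReal.ofReal p • Measure.dirac 0 + ENNReal.ofReal (1 - p) • Measure.dirac 1

theorem isProbabilityMeasure_coin {p : ℝ} (hp : p ∈ Set.Ioo (0 : ℝ) 1) :
    IsProbabilityMeasure (coin p) := by
  refine ⟨?_⟩
  simp only [coin, Measure.coe_add, Measure.coe_smul, Pi.add_apply, Pi.smul_apply, measure_univ,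
    smul_eq_mul, mul_one]
  rw [← ENNReal.ofReal_add hp.1.le (sub_nonneg.2 hp.2.le)]
  simp

/-- Turn an arbitrary sequence into a point of `XG`, by setting to zero the coordinates which are
forced to vanish. -/
def sieve (y : ℕ → Fin 2) (k : ℕ) : Fin 2 :=
  if Even k then y k else if sieve y (k / 2) = 0 then y k else 0
termination_by k
decreasing_by
  have : k ≠ 0 := by
    rintro rfl
    simp_all
  omega

theorem sieve_eq (y : ℕ → Fin 2) (k : ℕ) :
    sieve y k = if Even k ∨ sieve y (k / 2) = 0 then y k else 0 := by
  rw [sieve]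
  split_ifs <;> tauto

theorem sieve_mem_XG (y : ℕ → Fin 2) : ofSeq (sieve y) ∈ XG := by
  refine (mem_XG_iff _).2 fun k hk => ?_
  change sieve y (k / 2) = 0 ∨ sieve y k = 0
  by_cases h : sieve y (k / 2) = 0
  · exact Or.inl h
  · refine Or.inr ?_
    rw [sieve_eq, if_neg (by tauto)]

theorem measurable_sieve_apply (k : ℕ) : Measurable fun y => sieve y k := by
  induction k using Nat.strong_induction_on with
  | _ k ih =>
    by_cases hk : Even k
    · simp only [sieve_eq _ k, hk, true_or, if_true]
      exact measurable_pi_apply k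
    · simp only [sieve_eq _ k, hk, false_or]
      have : k / 2 < k := lt_of_le_of_ne (Nat.div_le_self _ _) (div_two_ne_of_not_even hk)
      exact Measurable.ite (ih _ this (measurableSet_singleton 0)) (measurable_pi_apply k)
        measurable_const

theorem measurable_sieve : Measurable fun y => ofSeq (sieve y) :=
  continuous_ofSeq.measurable.comp (measurable_pi_iff.2 measurable_sieve_apply)

/-- The law of the sieve of a sequence of independent coin tosses. -/
noncomputable def sieveMeasure (p : ℝ) [IsProbabilityMeasure (coin p)] : Measure SigmaTwo :=
  (Measure.infinitePi fun _ : ℕ => coin p).map fun y => ofSeq (sieve y)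

instance (p : ℝ) [IsProbabilityMeasure (coin p)] : IsProbabilityMeasure (sieveMeasure p) :=
  Measure.isProbabilityMeasure_map measurable_sieve.aemeasurable

theorem ae_mem_XG (p : ℝ) [IsProbabilityMeasure (coin p)] : ∀ᵐ x ∂sieveMeasure p, x ∈ XG :=
  (ae_map_iff measurable_sieve.aemeasurable measurableSet_XG).2 (Eventually.of_forall sieve_mem_XG)

open Finset in
theorem sieveMeasure_cylinder_le {p : ℝ} [IsProbabilityMeasure (coin p)]
    (hp : p ∈ Set.Ioo (0 : ℝ) 1) (x : SigmaTwo) (n : ℕ) :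
    sieveMeasure p (cylinder x n) ≤ ENNReal.ofReal (weight p n (toSeq x)) := by
  rw [sieveMeasure, Measure.map_apply measurable_sieve (measurableSet_cylinder x n)]
  set A : ℕ → Set (Fin 2) := fun k =>
    {b | if Even k ∨ toSeq x (k / 2) = 0 then b = toSeq x k else toSeq x k = 0} with hA
  have hsub : (fun y => ofSeq (sieve y)) ⁻¹' cylinder x n ⊆
      Set.pi (range n : Finset ℕ) A := by
    intro y hy k hk
    have hy' : ∀ i < n, sieve y i = toSeq x i := hy
    have hkn : k < n := mem_range.1 hk
    have h := sieve_eq y k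
    rw [hy' k hkn, hy' (k / 2) (by omega)] at h
    change if _ then _ else _
    split_ifs at h ⊢
    · exact h.symm
    · exact h
  refine (measure_mono hsub).trans ?_
  rw [Measure.infinitePi_pi _ fun k _ => (Set.toFinite _).measurableSet, weight,
    ENNReal.ofReal_prod_of_nonneg fun k _ => transition_nonneg hp k _]
  refine (prod_congr rfl fun k _ => ?_).le
  have hx : toSeq x k = 0 ∨ toSeq x k = 1 := by omega
  by_cases h1 : Even k ∨ toSeq x (k / 2) = 0
  · have hAk : A k = {toSeq x k} := by
      ext b
      simp only [hA, if_pos h1]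
      rfl
    rw [hAk, transition, if_pos h1]
    rcases hx with h | h <;> simp [coin, h]
  · rw [transition, if_neg h1]
    by_cases h : toSeq x k = 0
    · have hAk : A k = Set.univ := by
        ext b
        simp only [hA, if_neg h1, h]
        simp
      rw [hAk, measure_univ, if_pos h, ENNReal.ofReal_one]
    · have hAk : A k = ∅ := by
        ext b
        simp only [hA, if_neg h1, h]
        simp
      rw [hAk, measure_empty, if_neg h, ENNReal.ofReal_zero]

theorem deviation_congr (p : ℝ) (n : ℕ) (x y : ℕ → Fin 2) (h : ∀ i < n, x i = y i) :
    deviation p n x = deviation p n y := by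
  rw [deviation, deviation, ones_congr n x y h, ones_congr (n / 2) x y fun i hi => h i (by omega)]

open Classical in
theorem sieveMeasure_deviation_le {p : ℝ} [IsProbabilityMeasure (coin p)]
    (hp : p ∈ Set.Ioo (0 : ℝ) 1) {ε u : ℝ} (hε : 0 < ε) (hε2 : ε ≤ 2) (hu : |u| = 1) (n : ℕ) :
    sieveMeasure p {x | ε * n < u * deviation p n (toSeq x)} ≤
      ENNReal.ofReal (Real.exp (-(ε ^ 2 / 4))) ^ n := by
  set B : Finset (Fin n → Fin 2) := {w | ε * n < u * deviation p n (extendZero w)} with hB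
  have hsub : {x : SigmaTwo | ε * n < u * deviation p n (toSeq x)} ⊆
      ⋃ w ∈ B, cylinder (extendZero w) n := by
    intro x hx
    have hw : ∀ i < n, extendZero (fun a : Fin n => toSeq x a) i = toSeq x i :=
      fun i hi => extendZero_restrict _ hi
    refine Set.mem_iUnion₂.2 ⟨fun a => toSeq x a, ?_, fun i hi => (hw i hi).symm⟩
    rw [hB, Finset.mem_filter, deviation_congr p n _ _ hw]
    exact ⟨Finset.mem_univ _, hx⟩
  have ht : |u * (ε / 2)| ≤ 1 := by
    rw [abs_mul, hu, one_mul, abs_of_pos (by linarith)]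
    linarith
  have hnn : ∀ w : Fin n → Fin 2, 0 ≤ weight p n (extendZero w) *
      Real.exp (u * (ε / 2) * deviation p n (extendZero w)) * Real.exp (-(ε ^ 2 / 2 * n)) :=
    fun w => mul_nonneg (mul_nonneg (weight_nonneg hp _ _) (Real.exp_pos _).le) (Real.exp_pos _).le
  calc _ ≤ ∑ w ∈ B, sieveMeasure p (cylinder (extendZero w) n) :=
        (measure_mono hsub).trans (measure_biUnion_finset_le _ _)
    _ ≤ ∑ w ∈ B, ENNReal.ofReal (weight p n (extendZero w) *
          Real.exp (u * (ε / 2) * deviation p n (extendZero w)) *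
          Real.exp (-(ε ^ 2 / 2 * n))) := by
        refine Finset.sum_le_sum fun w hw => (sieveMeasure_cylinder_le hp _ n).trans
          (ENNReal.ofReal_le_ofReal ?_)
        have hdev := (Finset.mem_filter.1 hw).2
        rw [mul_assoc, ← Real.exp_add]
        refine le_mul_of_one_le_right (weight_nonneg hp _ _) (Real.one_le_exp ?_)
        nlinarith
    _ ≤ ∑ w : Fin n → Fin 2, ENNReal.ofReal (weight p n (extendZero w) *
          Real.exp (u * (ε / 2) * deviation p n (extendZero w)) *
          Real.exp (-(ε ^ 2 / 2 * n))) :=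
        Finset.sum_le_sum_of_subset (Finset.subset_univ _)
    _ ≤ ENNReal.ofReal (Real.exp (-(ε ^ 2 / 4)) ^ n) := by
        rw [← ENNReal.ofReal_sum_of_nonneg fun w _ => hnn w, ← Finset.sum_mul]
        refine ENNReal.ofReal_le_ofReal ?_
        have h := sum_word_weight_mul_exp_le hp ht n
        simp only [sum_eq_deviation] at h
        refine (mul_le_mul_of_nonneg_right h (Real.exp_pos _).le).trans_eq ?_
        have hu2 : u ^ 2 = 1 := by rw [← sq_abs, hu, one_pow]
        rw [← Real.exp_nat_mul, ← Real.exp_nat_mul, ← Real.exp_add, mul_pow, hu2]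
        congr 1
        ring
    _ = _ := ENNReal.ofReal_pow (Real.exp_pos _).le n

theorem ae_eventually_abs_deviation_le {p : ℝ} [IsProbabilityMeasure (coin p)]
    (hp : p ∈ Set.Ioo (0 : ℝ) 1) {ε : ℝ} (hε : 0 < ε) (hε2 : ε ≤ 2) :
    ∀ᵐ x ∂sieveMeasure p, ∃ N : ℕ, ∀ n ≥ N, |deviation p n (toSeq x)| ≤ ε * n := by
  have key : ∀ u : ℝ, |u| = 1 → ∀ᵐ x ∂sieveMeasure p, ∀ᶠ n : ℕ in atTop,
      u * deviation p n (toSeq x) ≤ ε * n := by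
    intro u hu
    have := ae_eventually_notMem (μ := sieveMeasure p)
      (s := fun n : ℕ => {x | ε * n < u * deviation p n (toSeq x)}) ?_
    · filter_upwards [this] with x hx
      filter_upwards [hx] with n hn
      exact not_lt.1 hn
    · refine ne_top_of_le_ne_top ?_
        (ENNReal.tsum_le_tsum fun n => sieveMeasure_deviation_le hp hε hε2 hu n)
      rw [ENNReal.tsum_geometric, Ne, ENNReal.inv_eq_top, tsub_eq_zero_iff_le, not_le,
        ENNReal.ofReal_lt_one, Real.exp_lt_one_iff]
      have := pow_pos hε 2
      linarith
  filter_upwards [key 1 (by simp), key (-1) (by simp)] with x h1 h2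
  obtain ⟨N, hN⟩ := eventually_atTop.1 (h1.and h2)
  refine ⟨N, fun n hn => abs_le.2 ?_⟩
  have := hN n hn
  constructor <;> linarith [this.1, this.2]

/-- The points of `XG` whose deviations are at most `ε * n` from `N` on. -/
def regular (p ε : ℝ) (N : ℕ) : Set SigmaTwo :=
  {x | x ∈ XG ∧ ∀ n ≥ N, |deviation p n (toSeq x)| ≤ ε * n}

theorem measurableSet_regular (p ε : ℝ) (N : ℕ) : MeasurableSet (regular p ε N) := by
  have : regular p ε N =
      XG ∩ ⋂ n : ℕ, ⋂ _ : N ≤ n, {x | |deviation p n (toSeq x)| ≤ ε * n} := by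
    ext x
    simp [regular]
  rw [this]
  exact measurableSet_XG.inter (MeasurableSet.iInter fun n => MeasurableSet.iInter fun _ =>
    measurableSet_le (measurable_deviation p n).abs measurable_const)

theorem exists_regular_ne_zero {p : ℝ} [IsProbabilityMeasure (coin p)]
    (hp : p ∈ Set.Ioo (0 : ℝ) 1) {ε : ℝ} (hε : 0 < ε) (hε2 : ε ≤ 2) :
    ∃ N, sieveMeasure p (regular p ε N) ≠ 0 := by
  by_contra! H
  have h : ∀ᵐ x ∂sieveMeasure p, x ∈ ⋃ N, regular p ε N := by
    filter_upwards [ae_mem_XG p, ae_eventually_abs_deviation_le hp hε hε2] with x hx ⟨N, hN⟩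
    exact Set.mem_iUnion.2 ⟨N, hx, hN⟩
  have h1 := prob_compl_eq_zero_iff (μ := sieveMeasure p)
    (MeasurableSet.iUnion (measurableSet_regular p ε)) |>.1 h
  rw [measure_iUnion_null H] at h1
  exact zero_ne_one h1

theorem restrict_regular_le {p : ℝ} [IsProbabilityMeasure (coin p)] (hp : p ∈ Set.Ioo (0 : ℝ) 1)
    (hpe : p ^ 3 = (1 - p) ^ 2) {ε : ℝ} (hε : 0 < ε) {N m : ℕ}
    (hm : 2 * (N + 1 / p) + 2 ≤ ε * m) {E : Set SigmaTwo}
    (hE : Metric.ediam E ≤ ENNReal.ofReal ((1 / 2) ^ (m + 1))) :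
    (sieveMeasure p).restrict (regular p ε N) E ≤
      ENNReal.ofReal ((p ^ (1 - 3 * ε)) ^ (m + 2)) := by
  rw [Measure.restrict_apply' (measurableSet_regular p ε N)]
  rcases (E ∩ regular p ε N).eq_empty_or_nonempty with h | ⟨x, hxE, hxG, hx⟩
  · simp [h]
  · have hsub : E ∩ regular p ε N ⊆ cylinder x m := by
      rintro y ⟨hy, -⟩
      have := (Metric.edist_le_ediam_of_mem hxE hy).trans hE
      rw [edist_dist, ENNReal.ofReal_le_ofReal_iff (by positivity)] at this
      exact (dist_le_iff x y m).1 this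
    refine (measure_mono hsub).trans ((sieveMeasure_cylinder_le hp x m).trans
      (ENNReal.ofReal_le_ofReal
        ((weight_le hp hpe hε ((mem_XG_iff x).1 hxG) hx m).trans ?_)))
    rw [← Real.rpow_natCast, ← Real.rpow_mul hp.1.le]
    refine Real.rpow_le_rpow_of_exponent_ge hp.1 hp.2.le ?_
    push_cast
    nlinarith

theorem le_dimH_XG {p ε : ℝ} (hp : p ∈ Set.Ioo (0 : ℝ) 1) (hpe : p ^ 3 = (1 - p) ^ 2)
    (hε : 0 < ε) (hε3 : ε < 1 / 3) :
    ENNReal.ofReal (-Real.logb 2 p * (1 - 3 * ε)) ≤ dimH XG := by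
  have hd : 0 < -Real.logb 2 p * (1 - 3 * ε) := mul_pos (neg_logb_pos hp) (by linarith)
  have := isProbabilityMeasure_coin hp
  obtain ⟨N, hN⟩ := exists_regular_ne_zero hp hε (by linarith)
  obtain ⟨m₀, hm₀⟩ := exists_nat_ge ((2 * (N + 1 / p) + 2) / ε)
  rw [div_le_iff₀' hε] at hm₀
  have hm : ∀ m ≥ m₀, 2 * (N + 1 / p) + 2 ≤ ε * m := fun m h =>
    hm₀.trans (mul_le_mul_of_nonneg_left (by exact_mod_cast h) hε.le)
  refine le_dimH_of_hausdorffMeasure_ne_zero (d := (-Real.logb 2 p * (1 - 3 * ε)).toNNReal) ?_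
  rw [Real.coe_toNNReal _ hd.le]
  have hle := Measure.le_hausdorffMeasure (-Real.logb 2 p * (1 - 3 * ε))
    ((sieveMeasure p).restrict (regular p ε N)) (ENNReal.ofReal ((1 / 2) ^ (m₀ + 2)))
    (ENNReal.ofReal_pos.2 (by positivity)) fun E hE => ?_
  · intro h0
    have h1 := le_trans (hle XG) h0.le
    rw [Measure.restrict_apply' (measurableSet_regular p ε N),
      Set.inter_eq_right.2 fun x hx => hx.1] at h1
    exact hN (le_antisymm h1 zero_le)
  · rcases eq_or_ne (Metric.ediam E) 0 with h0 | h0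
    · refine le_trans ?_ zero_le
      have hlim : Tendsto (fun m : ℕ => ENNReal.ofReal ((p ^ (1 - 3 * ε)) ^ (m + 2))) atTop
          (nhds 0) := by
        rw [← ENNReal.ofReal_zero]
        exact ENNReal.tendsto_ofReal ((tendsto_add_atTop_iff_nat 2).2
          (tendsto_pow_atTop_nhds_zero_of_lt_one (Real.rpow_nonneg hp.1.le _)
            (Real.rpow_lt_one hp.1.le hp.2 (by linarith))))
      refine ge_of_tendsto hlim (eventually_atTop.2 ⟨m₀, fun m h => ?_⟩)
      exact restrict_regular_le hp hpe hε (hm m h) (h0.trans_le zero_le)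
    · have htop : Metric.ediam E ≠ ⊤ := ne_top_of_le_ne_top ENNReal.ofReal_ne_top hE
      obtain ⟨δ, hδ, hδE⟩ : ∃ δ : ℝ, 0 < δ ∧ Metric.ediam E = ENNReal.ofReal δ :=
        ⟨_, ENNReal.toReal_pos h0 htop, (ENNReal.ofReal_toReal htop).symm⟩
      rw [hδE, ENNReal.ofReal_le_ofReal_iff (by positivity)] at hE
      obtain ⟨n, hn1, hn2⟩ := exists_nat_pow_near_of_lt_one hδ
        (hE.trans (pow_le_one₀ (by norm_num) (by norm_num))) (by norm_num : (0 : ℝ) < 1 / 2)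
        (by norm_num)
      have hnm : m₀ + 2 < n + 1 :=
        (pow_lt_pow_iff_right_of_lt_one₀ (by norm_num) (by norm_num)).1 (hn1.trans_le hE)
      obtain ⟨m, rfl⟩ : ∃ m, n = m + 1 := ⟨n - 1, by omega⟩
      refine (restrict_regular_le hp hpe hε (hm m (by omega))
        (hδE.trans_le (ENNReal.ofReal_le_ofReal hn2))).trans ?_
      rw [hδE, ENNReal.ofReal_rpow_of_pos hδ]
      refine ENNReal.ofReal_le_ofReal ?_
      rw [← Real.rpow_natCast, ← Real.rpow_mul hp.1.le, mul_comm, ← half_pow_rpow hp.1]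
      exact Real.rpow_le_rpow (by positivity) hn1.le hd.le

/-- The Hausdorff dimension of the symbolic multiplicative golden mean shift `X_G ⊆ (Σ₂, ρ)`
is `-log₂ p`, where `p` is the unique root in `(0,1)` of `p³ = (1-p)²`. -/
theorem dimH_XG (p : ℝ) (hp : p ∈ Set.Ioo (0 : ℝ) 1) (hpe : p ^ 3 = (1 - p) ^ 2) :
    dimH XG = ENNReal.ofReal (-Real.logb 2 p) := by
  have hlim : ∀ c : ℝ, Tendsto (fun ε : ℝ => ENNReal.ofReal (-Real.logb 2 p * (1 + c * ε)))
      (nhdsWithin 0 (Set.Ioi 0)) (nhds (ENNReal.ofReal (-Real.logb 2 p))) := by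
    intro c
    refine ENNReal.tendsto_ofReal (tendsto_nhdsWithin_of_tendsto_nhds ?_)
    have : Continuous fun ε : ℝ => -Real.logb 2 p * (1 + c * ε) := by fun_prop
    simpa using this.tendsto 0
  refine le_antisymm (ge_of_tendsto (hlim 2) ?_) (le_of_tendsto (hlim (-3)) ?_)
  · filter_upwards [self_mem_nhdsWithin] with ε hε
    exact dimH_XG_le hp hpe hε
  · filter_upwards [Ioo_mem_nhdsGT (show (0 : ℝ) < 1 / 3 by norm_num)] with ε hε
    rw [show 1 + -3 * ε = 1 - 3 * ε by ring]
    exact le_dimH_XG hp hpe hε.1 hε.2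

end SigmaTwo
end

section
/- Let 0 < p < 1 and let μ_p be the Markov measure on Σ_G with initial distribution (p, 1-p) on symbols (0,1) and transition probabilities P(0,0) = p, P(0,1) = 1-p, P(1,0) = 1, P(1,1) = 0. Then s(μ_p) = Σ_{k≥1} H^{μ_p}(α_k)/2^{k+1} = 2H(p)/(3-p), where H(p) = -p log₂ p - (1-p) log₂(1-p). -/
open scoped ENNReal
open Filter MeasureTheory

namespace SigmaTwo

attribute [local instance] PiNat.dist

/-- The cell of the partition `α_k` of `Σ_G` corresponding to a word `w = w_1 … w_k`:
the set of sequences in `Σ_G` starting with `w`. -/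
def cellG {k : ℕ} (w : Fin k → Fin 2) : Set SigmaTwo :=
  {y | y ∈ SigmaG ∧ ∀ i : Fin k, y (i : ℕ) = w i}

/-- `H^μ(α_k) = -∑_{C ∈ α_k} μ(C) log₂ μ(C)`, the base-2 entropy of the partition `α_k` of
`Σ_G` into cylinders of length `k` (cells of measure zero contribute `0`). -/
noncomputable def partEntropy (μ : Measure SigmaTwo) (k : ℕ) : ℝ :=
  -∑ w : Fin k → Fin 2, (μ (cellG w)).toReal * Real.logb 2 (μ (cellG w)).toReal

/-- `s(μ) = ∑_{k ≥ 1} H^μ(α_k) / 2^(k+1)`. -/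
noncomputable def sOf (μ : Measure SigmaTwo) : ℝ :=
  ∑' k : ℕ, partEntropy μ (k + 1) / 2 ^ (k + 2)

/-- The initial distribution `(p, 1 - p)` on the symbols `(0, 1)`. -/
noncomputable def initP (p : ℝ) : Fin 2 → ℝ := ![p, 1 - p]

/-- The transition probabilities `P(0,0) = p`, `P(0,1) = 1 - p`, `P(1,0) = 1`, `P(1,1) = 0`. -/
noncomputable def transP (p : ℝ) : Fin 2 → Fin 2 → ℝ := ![![p, 1 - p], ![1, 0]]

/-- `μ` is the Markov measure with initial distribution `(p, 1-p)` and transition matrix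
`transP p`: the cylinder `[u_1 … u_{k+1}]` has mass `p_{u_1} P(u_1,u_2) ⋯ P(u_k,u_{k+1})`. -/
def IsMarkov (p : ℝ) (μ : Measure SigmaTwo) : Prop :=
  ∀ (k : ℕ) (w : Fin (k + 1) → Fin 2),
    μ (cellG w) =
      ENNReal.ofReal (initP p (w 0) * ∏ j : Fin k, transP p (w j.castSucc) (w j.succ))

/-- The weight `P(i,w_1) P(w_1,w_2) ⋯ P(w_{k-1},w_k)` of the word `w` after the symbol `i`. -/
noncomputable def pathWeight (p : ℝ) : (k : ℕ) → Fin 2 → (Fin k → Fin 2) → ℝ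
  | 0, _, _ => 1
  | k + 1, i, w => transP p i (w 0) * pathWeight p k (w 0) (Fin.tail w)

/-- The base-2 entropy of the distribution `pathWeight p k i` on words of length `k`. -/
noncomputable def pathEntropy (p : ℝ) (k : ℕ) (i : Fin 2) : ℝ :=
  -∑ w : Fin k → Fin 2, pathWeight p k i w * Real.logb 2 (pathWeight p k i w)

theorem pathWeight_cons (p : ℝ) (k : ℕ) (i j : Fin 2) (v : Fin k → Fin 2) :
    pathWeight p (k + 1) i (Fin.cons j v) = transP p i j * pathWeight p k j v := by
  simp [pathWeight]

theorem transP_nonneg {p : ℝ} (hp : p ∈ Set.Ioo (0 : ℝ) 1) (i j : Fin 2) :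
    0 ≤ transP p i j := by
  have h0 := hp.1.le
  have h1 := hp.2.le
  fin_cases i <;> fin_cases j <;> simp [transP, h0, h1]

theorem pathWeight_nonneg {p : ℝ} (hp : p ∈ Set.Ioo (0 : ℝ) 1) (k : ℕ) (i : Fin 2)
    (w : Fin k → Fin 2) : 0 ≤ pathWeight p k i w := by
  induction k generalizing i with
  | zero => simp [pathWeight]
  | succ k ih => exact mul_nonneg (transP_nonneg hp _ _) (ih _ _)

theorem sum_cons {k : ℕ} (f : (Fin (k + 1) → Fin 2) → ℝ) :
    ∑ w, f w = ∑ j : Fin 2, ∑ v : Fin k → Fin 2, f (Fin.cons j v) := by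
  rw [← (Fin.consEquiv fun _ : Fin (k + 1) => Fin 2).sum_comp, Fintype.sum_prod_type]
  rfl

theorem sum_transP (p : ℝ) (i : Fin 2) : ∑ j, transP p i j = 1 := by
  fin_cases i <;> simp [transP]

theorem sum_pathWeight (p : ℝ) (k : ℕ) (i : Fin 2) : ∑ w, pathWeight p k i w = 1 := by
  induction k generalizing i with
  | zero => simp [pathWeight]
  | succ k ih => simp only [sum_cons, pathWeight_cons, ← Finset.mul_sum, ih, mul_one, sum_transP]

theorem mul_logb_mul (a b : ℝ) :
    a * b * Real.logb 2 (a * b) = a * Real.logb 2 a * b + a * (b * Real.logb 2 b) := by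
  rcases eq_or_ne a 0 with rfl | ha
  · simp
  rcases eq_or_ne b 0 with rfl | hb
  · simp
  rw [Real.logb_mul ha hb]
  ring

theorem pathEntropy_succ (p : ℝ) (k : ℕ) (i : Fin 2) :
    pathEntropy p (k + 1) i =
      ∑ j, (-(transP p i j * Real.logb 2 (transP p i j)) + transP p i j * pathEntropy p k j) := by
  simp only [pathEntropy, sum_cons, pathWeight_cons, mul_logb_mul, Finset.sum_add_distrib,
    ← Finset.mul_sum, sum_pathWeight, mul_one, mul_neg, Finset.sum_neg_distrib, neg_add]

theorem pathEntropy_zero (p : ℝ) (i : Fin 2) : pathEntropy p 0 i = 0 := by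
  simp [pathEntropy, pathWeight]

theorem pathEntropy_succ_zero (p : ℝ) (k : ℕ) :
    pathEntropy p (k + 1) 0 = (-(p * Real.logb 2 p) - (1 - p) * Real.logb 2 (1 - p)) +
      p * pathEntropy p k 0 + (1 - p) * pathEntropy p k 1 := by
  rw [pathEntropy_succ, Fin.sum_univ_two]
  simp only [transP, Matrix.cons_val_zero, Matrix.cons_val_one]
  ring

theorem pathEntropy_succ_one (p : ℝ) (k : ℕ) :
    pathEntropy p (k + 1) 1 = pathEntropy p k 0 := by
  rw [pathEntropy_succ, Fin.sum_univ_two]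
  simp [transP]

theorem pathWeight_eq_prod (p : ℝ) (k : ℕ) (i : Fin 2) (w : Fin (k + 1) → Fin 2) :
    pathWeight p (k + 1) i w =
      transP p i (w 0) * ∏ j : Fin k, transP p (w j.castSucc) (w j.succ) := by
  induction k generalizing i with
  | zero => simp [pathWeight]
  | succ k ih =>
    rw [pathWeight, ih, Fin.prod_univ_succ]
    rfl

theorem partEntropy_eq_pathEntropy {p : ℝ} (hp : p ∈ Set.Ioo (0 : ℝ) 1)
    {μ : Measure SigmaTwo} (hμ : IsMarkov p μ) (k : ℕ) :
    partEntropy μ (k + 1) = pathEntropy p (k + 1) 0 := by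
  have h (w : Fin (k + 1) → Fin 2) : (μ (cellG w)).toReal = pathWeight p (k + 1) 0 w := by
    have hw : initP p (w 0) * ∏ j : Fin k, transP p (w j.castSucc) (w j.succ) =
        pathWeight p (k + 1) 0 w := (pathWeight_eq_prod p k 0 w).symm
    rw [hμ, hw, ENNReal.toReal_ofReal (pathWeight_nonneg hp _ _ _)]
  simp only [partEntropy, pathEntropy, h]

theorem tsum_div_two_pow_of_recurrence {p h : ℝ} (hp : p ∈ Set.Ioo (0 : ℝ) 1) (hh : 0 ≤ h)
    {a : ℕ → ℝ} (a0 : a 0 = 0) (a1 : a 1 = h)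
    (ha : ∀ k, a (k + 2) = h + p * a (k + 1) + (1 - p) * a k) :
    ∑' k, a (k + 1) / 2 ^ (k + 2) = 2 * h / (3 - p) := by
  have hp0 := hp.1
  have hp1 := hp.2
  have bound (k : ℕ) : (0 ≤ a k ∧ a k ≤ k * h) ∧ 0 ≤ a (k + 1) ∧ a (k + 1) ≤ (k + 1) * h := by
    induction k with
    | zero => simp [a0, a1, hh]
    | succ k ih =>
      obtain ⟨⟨l, u⟩, l', u'⟩ := ih
      push_cast
      refine ⟨⟨l', u'⟩, ?_, ?_⟩
      · rw [ha]
        have := mul_nonneg hp0.le l'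
        have := mul_nonneg (sub_nonneg.2 hp1.le) l
        linarith
      · rw [ha]
        have := mul_le_mul_of_nonneg_left u' hp0.le
        have := mul_le_mul_of_nonneg_left u (sub_nonneg.2 hp1.le)
        nlinarith [mul_nonneg (sub_nonneg.2 hp1.le) hh]
  have geom : HasSum (fun k : ℕ => h / 8 * (1 / 2) ^ k) (h / 8 * 2) :=
    hasSum_geometric_two.mul_left _
  have lin : Summable fun k : ℕ => (k : ℝ) * (1 / 2) ^ k := by
    simpa using summable_pow_mul_geometric_of_norm_lt_one (r := (1 / 2 : ℝ)) 1 (by norm_num)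
  have hs : Summable fun k => a k / 2 ^ (k + 1) := by
    refine .of_nonneg_of_le (fun k => div_nonneg (bound k).1.1 (by positivity)) (fun k => ?_)
      (lin.mul_left (h / 2))
    calc a k / 2 ^ (k + 1) ≤ k * h / 2 ^ (k + 1) := by gcongr; exact (bound k).1.2
      _ = h / 2 * (k * (1 / 2) ^ k) := by rw [pow_succ, one_div, inv_pow]; field_simp
  have hs1 : Summable fun k => a (k + 1) / 2 ^ (k + 2) := (summable_nat_add_iff 1).2 hs
  have e0 := hs.tsum_eq_zero_add
  have e1 := hs1.tsum_eq_zero_add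
  have e2 : ∑' k, a (k + 1 + 1) / 2 ^ (k + 1 + 2) =
      h / 8 * 2 + p / 2 * ∑' k, a (k + 1) / 2 ^ (k + 2) +
        (1 - p) / 4 * ∑' k, a k / 2 ^ (k + 1) := by
    refine HasSum.tsum_eq ?_
    convert (geom.add (hs1.hasSum.mul_left (p / 2))).add (hs.hasSum.mul_left ((1 - p) / 4)) using 2
      with k
    rw [ha, one_div, inv_pow]
    field_simp
    ring
  simp only [a0, a1, zero_add, zero_div] at e0 e1
  rw [e2, e0] at e1
  rw [eq_div_iff (by linarith)]
  linarith

/-- For the Markov measure `μ_p` on `Σ_G`,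
`s(μ_p) = ∑_{k ≥ 1} H^{μ_p}(α_k)/2^{k+1} = 2 H(p)/(3-p)` where
`H(p) = -p log₂ p - (1-p) log₂ (1-p)`. -/
theorem sOf_markov (p : ℝ) (hp : p ∈ Set.Ioo (0 : ℝ) 1) (μ : Measure SigmaTwo)
    [IsProbabilityMeasure μ] (hsupp : μ SigmaG = 1) (hμ : IsMarkov p μ) :
    sOf μ = 2 * (-(p * Real.logb 2 p) - (1 - p) * Real.logb 2 (1 - p)) / (3 - p) := by
  have hh : 0 ≤ -(p * Real.logb 2 p) - (1 - p) * Real.logb 2 (1 - p) := by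
    have h0 := mul_nonpos_of_nonneg_of_nonpos hp.1.le
      (Real.logb_nonpos one_lt_two hp.1.le hp.2.le)
    have h1 := mul_nonpos_of_nonneg_of_nonpos (sub_nonneg.2 hp.2.le)
      (Real.logb_nonpos one_lt_two (sub_nonneg.2 hp.2.le) (sub_le_self 1 hp.1.le))
    linarith
  simp only [sOf, partEntropy_eq_pathEntropy hp hμ]
  refine tsum_div_two_pow_of_recurrence (a := fun k => pathEntropy p k 0) hp hh
    (pathEntropy_zero p 0) ?_ fun k => ?_
  · simp [pathEntropy_succ_zero p 0, pathEntropy_zero]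
  · rw [pathEntropy_succ_zero p (k + 1), pathEntropy_succ_one]

end SigmaTwo
end

section
/- Let H(p) = -p log₂ p - (1-p) log₂(1-p) for p ∈ (0,1), and let p* be the unique p ∈ (0,1) with p^3 = (1-p)^2. Then the function p ↦ 2H(p)/(3-p) on (0,1) attains its maximum at p = p*, and its maximum value equals -log₂ p*. -/
/-- Gibbs' inequality for Bernoulli distributions: the entropy of `p` is at most its cross-entropy
relative to `q`. -/
theorem bernoulli_entropy_le_crossEntropy {b p q : ℝ} (hb : 1 < b) (hp : p ∈ Set.Ioo (0 : ℝ) 1)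
    (hq : q ∈ Set.Ioo (0 : ℝ) 1) :
    -(p * Real.logb b p) - (1 - p) * Real.logb b (1 - p) ≤
      -(p * Real.logb b q) - (1 - p) * Real.logb b (1 - q) := by
  have key {x y : ℝ} (hx : 0 < x) (hy : 0 < y) :
      x * Real.log y - x * Real.log x ≤ y - x := by
    have h := mul_le_mul_of_nonneg_left (Real.log_le_sub_one_of_pos (div_pos hy hx)) hx.le
    rw [Real.log_div hy.ne' hx.ne', mul_sub, mul_sub, mul_div_cancel₀ y hx.ne', mul_one] at h
    exact h
  have h₁ := key hp.1 hq.1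
  have h₂ := key (sub_pos.2 hp.2) (sub_pos.2 hq.2)
  have h : -(p * Real.log p) - (1 - p) * Real.log (1 - p) ≤
      -(p * Real.log q) - (1 - p) * Real.log (1 - q) := by linarith
  have h' := div_le_div_of_nonneg_right h (Real.log_pos hb).le
  simpa only [Real.logb, sub_div, neg_div, mul_div_assoc] using h'

/-- The function `p ↦ 2H(p)/(3-p)` on `(0,1)`, where `H(p) = -p log₂ p - (1-p) log₂ (1-p)`
is the binary entropy function, attains its maximum at the unique root `p*` of
`p³ = (1-p)²` in `(0,1)`, and the maximum value is `-log₂ p*`. -/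
theorem isMaxOn_entropy_quotient (pstar : ℝ) (hp : pstar ∈ Set.Ioo (0 : ℝ) 1)
    (hpe : pstar ^ 3 = (1 - pstar) ^ 2) :
    IsMaxOn (fun p : ℝ => 2 * (-(p * Real.logb 2 p) - (1 - p) * Real.logb 2 (1 - p)) / (3 - p))
      (Set.Ioo (0 : ℝ) 1) pstar ∧
    2 * (-(pstar * Real.logb 2 pstar) - (1 - pstar) * Real.logb 2 (1 - pstar)) / (3 - pstar) =
      -Real.logb 2 pstar := by
  have hlog : 3 * Real.logb 2 pstar = 2 * Real.logb 2 (1 - pstar) := by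
    simpa [Real.logb_pow] using congrArg (Real.logb 2) hpe
  have hval : 2 * (-(pstar * Real.logb 2 pstar) - (1 - pstar) * Real.logb 2 (1 - pstar)) /
      (3 - pstar) = -Real.logb 2 pstar := by
    rw [div_eq_iff (by linarith [hp.2])]
    linear_combination (1 - pstar) * hlog
  refine ⟨isMaxOn_iff.2 fun p hp' => ?_, hval⟩
  rw [hval, div_le_iff₀ (by linarith [hp'.2])]
  have hgibbs := bernoulli_entropy_le_crossEntropy one_lt_two hp' hp
  linear_combination 2 * hgibbs + (1 - p) * hlog
end
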